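/- arXiv:2103.05816 — 4 statements merged into one kernel-verified Lean document; each statement's English description precedes it below -/
import Mathlib

section
/- If G is a graph of order 6 with χ(G) = 3 and G is not the disjoint union of two triangles, then B(G) ≥ 3. -/
open Finset

variable {V : Type*}

/-- A proper coloring given as a function to ℕ. -/
def IsProperColoring (G : SimpleGraph V) (c : V → ℕ) : Prop :=
  ∀ ⦃u v⦄, G.Adj u v → c u ≠ c v

variable [Fintype V] [DecidableEq V]

/-- Two colorings use every color the same number of times. -/
def SameColorCounts (c c' : V → ℕ) : Prop :=
  ∀ k : ℕ, (univ.filter fun v => c v = k).card = (univ.filter fun v => c' v = k).card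

/-- The number of vertices on which two colorings differ. -/
def recolorCount (c c' : V → ℕ) : ℕ := (univ.filter fun v => c v ≠ c' v).card

/-- The ℕ-valued chromatic number. -/
noncomputable def chromNum (G : SimpleGraph V) : ℕ := G.chromaticNumber.toNat

/-- A proper coloring of `G` using exactly `χ(G)` colors. -/
noncomputable def IsOptimalColoring (G : SimpleGraph V) (f : V → ℕ) : Prop :=
  IsProperColoring G f ∧ (univ.image f).card = chromNum G

/-- The villainy of a coloring `c`: the least number of vertices that must be
recolored to obtain a proper coloring using each color as often as `c` does. -/
noncomputable def colVillainy (G : SimpleGraph V) (c : V → ℕ) : ℕ :=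
  sInf {n | ∃ c', IsProperColoring G c' ∧ SameColorCounts c c' ∧ recolorCount c c' = n}

/-- `c` is a permutation of the coloring `f`. -/
def IsPermutationOf (c f : V → ℕ) : Prop := ∃ σ : Equiv.Perm V, c = f ∘ σ

/-- The villainy of `G`: the maximum villainy over all permutations of optimal
proper colorings of `G`. -/
noncomputable def villainy (G : SimpleGraph V) : ℕ :=
  sSup {n | ∃ f c, IsOptimalColoring G f ∧ IsPermutationOf c f ∧ colVillainy G c = n}


theorem SameColorCounts.isPermutationOf {c f : V → ℕ} (h : SameColorCounts c f) :
    IsPermutationOf c f := by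
  have e : ∀ k, Nonempty ({a // c a = k} ≃ {b // f b = k}) := by
    intro k
    apply Fintype.card_eq.mp
    rw [Fintype.card_subtype, Fintype.card_subtype]
    exact h k
  have e := fun k => (e k).some
  refine ⟨Equiv.ofFiberEquiv e, ?_⟩
  funext a
  exact (Equiv.ofFiberEquiv_map e a).symm

theorem IsPermutationOf.sameColorCounts {c f : V → ℕ} (h : IsPermutationOf c f) :
    SameColorCounts c f := by
  obtain ⟨σ, rfl⟩ := h
  intro k
  apply Finset.card_equiv σ
  intro i
  simp

theorem core (G : SimpleGraph V) (hchi : chromNum G = 3) (f c : V → ℕ)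
    (hf : IsProperColoring G f) (hf3 : ∀ v, f v < 3) (hc : SameColorCounts c f)
    (h : ∀ c', IsProperColoring G c' → SameColorCounts c c' → 3 ≤ recolorCount c c') :
    3 ≤ villainy G := by
  have hopt : IsOptimalColoring G f := by
    refine ⟨hf, ?_⟩
    apply le_antisymm
    · rw [hchi]
      calc (univ.image f).card ≤ (range 3).card := by
            apply Finset.card_le_card
            intro x hx
            obtain ⟨v, -, rfl⟩ := Finset.mem_image.mp hx
            exact Finset.mem_range.mpr (hf3 v)
        _ = 3 := by simp
    · let C : G.Coloring (univ.image f) :=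
        SimpleGraph.Coloring.mk (fun v => ⟨f v, Finset.mem_image_of_mem f (mem_univ v)⟩) (by
          intro u v huv he
          exact hf huv (by simpa using he))
      have h1 := C.colorable.chromaticNumber_le
      rw [Fintype.card_coe] at h1
      exact ENat.toNat_le_of_le_natCast h1
  have hle : ∀ n, n ∈ {n | ∃ f c, IsOptimalColoring G f ∧ IsPermutationOf c f ∧
      colVillainy G c = n} → n ≤ Fintype.card V := by
    rintro n ⟨f, c, hf, hc, rfl⟩
    calc colVillainy G c ≤ recolorCount c f :=
          Nat.sInf_le ⟨f, hf.1, hc.sameColorCounts, rfl⟩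
      _ ≤ _ := Finset.card_le_univ _
  have h1 : colVillainy G c ≤ villainy G :=
    le_csSup ⟨_, hle⟩ ⟨f, c, hopt, hc.isPermutationOf, rfl⟩
  refine le_trans ?_ h1
  refine le_csInf ⟨recolorCount c f, f, hf, hc, rfl⟩ ?_
  rintro n ⟨c', h1, h2, rfl⟩
  exact h c' h1 h2

/-- A triangle and a color class of size three. -/
theorem case_big (G : SimpleGraph V) (hchi : chromNum G = 3) (f : V → ℕ)
    (hf : IsProperColoring G f) (hf3 : ∀ v, f v < 3) (T x : Fin 3 → V)
    (hT : ∀ i j, i ≠ j → G.Adj (T i) (T j)) (hx : Function.Injective x) (A : ℕ)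
    (hA : ∀ i, f (x i) = A) : 3 ≤ villainy G := by
  have hTi : Function.Injective T := by
    intro i j hij
    by_contra hne
    have := hT i j hne
    rw [hij] at this
    exact G.loopless.irrefl _ this
  obtain ⟨σ, hσ⟩ := Equiv.Perm.exists_extending_pair T x hTi hx
  have hcT : ∀ i, f (σ (T i)) = A := fun i => by rw [hσ i, hA]
  refine core G hchi f (f ∘ σ) hf hf3 (IsPermutationOf.sameColorCounts ⟨σ, rfl⟩) ?_
  intro c' hp hs
  have hk := hs A
  set S := univ.filter fun v => (f ∘ σ) v = A with hS
  set S' := univ.filter fun v => c' v = A with hS'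
  have h2 : 2 ≤ (S \ S').card := by
    have h01 := hp (hT 0 1 (by decide))
    have h02 := hp (hT 0 2 (by decide))
    have h12 := hp (hT 1 2 (by decide))
    have key : ∃ i j, i ≠ j ∧ c' (T i) ≠ A ∧ c' (T j) ≠ A := by
      by_cases a0 : c' (T 0) = A
      · exact ⟨1, 2, by decide, by rw [← a0]; exact h01.symm, by rw [← a0]; exact h02.symm⟩
      · by_cases a1 : c' (T 1) = A
        · exact ⟨0, 2, by decide, a0, by rw [← a1]; exact h12.symm⟩
        · exact ⟨0, 1, by decide, a0, a1⟩
    obtain ⟨i, j, hij, hi, hj⟩ := key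
    rw [← Finset.card_pair (hTi.ne hij)]
    apply Finset.card_le_card
    intro v hv
    rcases Finset.mem_insert.mp hv with rfl | hv
    · simp [hS, hS', hcT, hi]
    · rw [Finset.mem_singleton] at hv
      subst hv
      simp [hS, hS', hcT, hj]
  have h3 : (S \ S').card = (S' \ S).card := Finset.card_sdiff_comm hk
  have h4 : (S \ S').card + (S' \ S).card ≤ recolorCount (f ∘ σ) c' := by
    rw [← Finset.card_union_of_disjoint]
    · apply Finset.card_le_card
      intro v hv
      simp only [hS, hS', mem_union, mem_sdiff, mem_filter, mem_univ, true_and] at hv ⊢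
      intro he
      rw [he] at hv
      tauto
    · exact disjoint_sdiff_sdiff
  omega

theorem counts_transfer (e : Fin 6 ≃ V) (c : V → ℕ) (k : ℕ) :
    (univ.filter fun v => c v = k).card = (univ.filter fun i => c (e i) = k).card := by
  symm
  apply Finset.card_equiv e
  intro i
  simp

/-- Reduction to checking colorings of six points. -/
theorem core6 (G : SimpleGraph V) (hchi : chromNum G = 3) (e : Fin 6 ≃ V) (f : V → ℕ)
    (c : Fin 6 → Fin 3)
    (hf : IsProperColoring G f) (hf3 : ∀ v, f v < 3)
    (hc : ∀ k : Fin 3, (univ.filter fun i => c i = k).card =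
      (univ.filter fun i => f (e i) = k).card)
    (h : ∀ d : Fin 6 → Fin 3, (∀ i j, G.Adj (e i) (e j) → d i ≠ d j) →
      (∀ k, (univ.filter fun i => c i = k).card = (univ.filter fun i => d i = k).card) →
      3 ≤ (univ.filter fun i => c i ≠ d i).card) : 3 ≤ villainy G := by
  refine core G hchi f (fun v => (c (e.symm v) : ℕ)) hf hf3 ?_ ?_
  · intro k
    rw [counts_transfer e, counts_transfer e]
    simp only [Equiv.symm_apply_apply]
    by_cases hk : k < 3
    · rw [← hc ⟨k, hk⟩]
      congr 1
      ext i
      simp [Fin.ext_iff]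
    · rw [Finset.filter_false_of_mem, Finset.filter_false_of_mem]
      · intro i _ hi
        exact hk (hi ▸ hf3 _)
      · intro i _ hi
        exact hk (hi ▸ (c i).2)
  · intro c' hp hs
    have hlt : ∀ v, c' v < 3 := by
      intro v
      by_contra hv
      have h1 := hs (c' v)
      rw [Finset.filter_false_of_mem (fun i _ (hi : (c (e.symm i) : ℕ) = c' v) =>
        hv (hi ▸ (c (e.symm i)).2))] at h1
      have h2 : v ∈ univ.filter fun w => c' w = c' v := by simp
      rw [Finset.card_empty] at h1
      rw [Finset.card_eq_zero.mp h1.symm] at h2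
      simp at h2
    have := h (fun i => ⟨c' (e i), hlt _⟩) (by
      intro i j hij he
      exact hp hij (by simpa using he)) (by
      intro k
      have h1 := hs k
      rw [counts_transfer e, counts_transfer e] at h1
      simp only [Equiv.symm_apply_apply] at h1
      simp only [Fin.ext_iff]
      exact h1)
    refine this.trans (le_of_eq ?_)
    apply Finset.card_equiv e
    intro i
    simp [Fin.ext_iff]

set_option synthInstance.maxHeartbeats 400000 in
set_option synthInstance.maxSize 2048 in
set_option maxHeartbeats 1000000 in
theorem dec_prism : ∀ a b c d e f : Fin 3, a ≠ b → a ≠ c → b ≠ c → c ≠ d →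
    (∀ k, (univ.filter fun i => ![0, 0, 1, 1, 2, 2] i = k).card =
      (univ.filter fun i => ![a, b, c, d, e, f] i = k).card) →
      3 ≤ (univ.filter fun i => ![(0 : Fin 3), 0, 1, 1, 2, 2] i ≠ ![a, b, c, d, e, f] i).card := by
  decide +kernel

set_option synthInstance.maxHeartbeats 400000 in
set_option synthInstance.maxSize 2048 in
set_option maxHeartbeats 1000000 in
theorem dec_cycle : ∀ a b c d e f : Fin 3, a ≠ b → b ≠ c → c ≠ d → d ≠ e → e ≠ a →
    (∀ k, (univ.filter fun i => ![0, 0, 0, 1, 1, 2] i = k).card =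
      (univ.filter fun i => ![a, b, c, d, e, f] i = k).card) →
      3 ≤ (univ.filter fun i => ![(0 : Fin 3), 0, 0, 1, 1, 2] i ≠ ![a, b, c, d, e, f] i).card := by
  decide +kernel

theorem eta6 {α : Type*} (d : Fin 6 → α) : d = ![d 0, d 1, d 2, d 3, d 4, d 5] := by
  funext i
  fin_cases i <;> rfl

theorem exists_odd (G : SimpleGraph V) (hn : Fintype.card V = 6) (h2 : ¬ G.Colorable 2) :
    (∃ a b c, G.Adj a b ∧ G.Adj a c ∧ G.Adj b c) ∨
    (∃ v : Fin 5 → V, Function.Injective v ∧ ∀ i, G.Adj (v i) (v (i + 1))) := by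
  classical
  rw [SimpleGraph.two_colorable_iff_forall_loop_even] at h2
  have hex : ∃ n, Odd n ∧ ∃ u, ∃ w : G.Walk u u, w.length = n := by
    push Not at h2
    obtain ⟨u, w, hw⟩ := h2
    exact ⟨_, Nat.not_even_iff_odd.mp hw, u, w, rfl⟩
  obtain ⟨hodd, u, w, hw⟩ := Nat.find_spec hex
  have hmin := fun m (hm : m < Nat.find hex) => Nat.find_min hex hm
  generalize Nat.find hex = n at *
  have hinj : ∀ i j, i < j → j < n → w.getVert i ≠ w.getVert j := by
    intro i j hij hj he
    let p : G.Walk (w.getVert i) (w.getVert i) := ((w.drop i).take (j - i)).copy rfl (by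
      rw [SimpleGraph.Walk.drop_getVert, he]; congr 1; omega)
    let q : G.Walk (w.getVert i) (w.getVert i) := ((w.drop j).append (w.take i)).copy he.symm rfl
    have hp : p.length = j - i := by
      simp [p, SimpleGraph.Walk.take_length, SimpleGraph.Walk.drop_length]; omega
    have hq : q.length = n - (j - i) := by
      simp [q, SimpleGraph.Walk.take_length, SimpleGraph.Walk.drop_length]; omega
    rcases Nat.even_or_odd (j - i) with hev | hod
    · exact hmin (n - (j - i)) (by omega)
        ⟨Nat.Odd.sub_even (by omega) hodd hev, _, q, hq⟩
    · exact hmin (j - i) (by omega) ⟨hod, _, p, hp⟩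
  have hadj : ∀ i, i < n → G.Adj (w.getVert i) (w.getVert (i + 1)) := fun i hi =>
    w.adj_getVert_succ (by omega)
  have hlast : w.getVert n = w.getVert 0 := by
    rw [← hw]; simp
  have hcard : n ≤ 6 := by
    have : Function.Injective (fun i : Fin n => w.getVert i) := by
      intro i j hij
      by_contra hne
      rcases lt_or_gt_of_ne hne with h | h
      · exact hinj i j h j.2 hij
      · exact hinj j i h i.2 hij.symm
    have := Fintype.card_le_of_injective _ this
    simpa [hn] using this
  have hcases : n = 1 ∨ n = 3 ∨ n = 5 := by
    obtain ⟨k, hk⟩ := hodd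
    omega
  rcases hcases with rfl | rfl | rfl
  · exfalso
    have := hadj 0 (by omega)
    rw [hlast] at this
    exact G.loopless.irrefl _ this
  · left
    refine ⟨w.getVert 0, w.getVert 1, w.getVert 2, hadj 0 (by omega), ?_, hadj 1 (by omega)⟩
    have := hadj 2 (by omega)
    rw [hlast] at this
    exact this.symm
  · right
    refine ⟨fun i => w.getVert i, ?_, ?_⟩
    · intro i j hij
      by_contra hne
      rcases lt_or_gt_of_ne hne with h | h
      · exact hinj i j h j.2 hij
      · exact hinj j i h i.2 hij.symm
    · intro i
      have := hadj i i.2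
      fin_cases i
      · exact this
      · exact this
      · exact this
      · exact this
      · change G.Adj (w.getVert 4) (w.getVert 0)
        rw [← hlast]
        exact this

theorem case_cycle (G : SimpleGraph V) (hn : Fintype.card V = 6) (hchi : chromNum G = 3)
    (hno : ¬ ∃ a b c, G.Adj a b ∧ G.Adj a c ∧ G.Adj b c)
    (v : Fin 5 → V) (hv : Function.Injective v) (hadj : ∀ i, G.Adj (v i) (v (i + 1))) :
    3 ≤ villainy G := by
  have hno' : ∀ a b c, G.Adj a b → G.Adj b c → ¬ G.Adj a c :=
    fun a b c h1 h2 h3 => hno ⟨a, b, c, h1, h3, h2⟩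
  obtain ⟨w, hw⟩ : ∃ w, ∀ i, v i ≠ w := by
    by_contra hcon
    push Not at hcon
    have : Function.Surjective v := hcon
    have := Fintype.card_le_of_surjective v this
    simp [hn] at this
  obtain ⟨r, hr⟩ : ∃ r : Fin 5, ¬ G.Adj w (v r) ∧ ¬ G.Adj w (v (r + 2)) := by
    have h : ∀ i, G.Adj w (v i) → ¬ G.Adj w (v (i + 1)) := fun i h1 => hno' _ _ _ h1 (hadj i)
    by_contra hcon
    push Not at hcon
    have h0 := h 0; have h1 := h 1; have h2 := h 2; have h3 := h 3; have h4 := h 4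
    have k0 := hcon 0; have k1 := hcon 1; have k2 := hcon 2; have k3 := hcon 3; have k4 := hcon 4
    simp only [Fin.isValue, Fin.reduceAdd] at *
    tauto
  let g : Fin 6 → V := ![v r, v (r + 1), v (r + 2), v (r + 3), v (r + 4), w]
  have hgi : Function.Injective g := by
    have hne : ∀ i j : Fin 5, i ≠ j → v i ≠ v j := fun i j => hv.ne
    have hd : ∀ r : Fin 5, r ≠ r + 1 ∧ r ≠ r + 2 ∧ r ≠ r + 3 ∧ r ≠ r + 4 ∧ r + 1 ≠ r + 2 ∧
      r + 1 ≠ r + 3 ∧ r + 1 ≠ r + 4 ∧ r + 2 ≠ r + 3 ∧ r + 2 ≠ r + 4 ∧ r + 3 ≠ r + 4 := by decide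
    have hd := hd r
    intro i j hij
    fin_cases i <;> fin_cases j <;> simp [g, hv.eq_iff, hw, (hw _).symm, hd] at hij ⊢ <;>
      first | (exact absurd hij (by tauto)) | (exact absurd hij.symm (by tauto))
  have hgb : Function.Bijective g :=
    (Fintype.bijective_iff_injective_and_card g).mpr ⟨hgi, by simp [hn]⟩
  let e := Equiv.ofBijective g hgb
  have a01 : G.Adj (e 0) (e 1) := hadj r
  have a12 : G.Adj (e 1) (e 2) := by
    have := hadj (r + 1); rwa [add_assoc] at this
  have a23 : G.Adj (e 2) (e 3) := by
    have := hadj (r + 2); rwa [add_assoc] at this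
  have a34 : G.Adj (e 3) (e 4) := by
    have := hadj (r + 3); rwa [add_assoc] at this
  have a40 : G.Adj (e 4) (e 0) := by
    have := hadj (r + 4); rw [add_assoc, show (4 + 1 : Fin 5) = 0 from rfl, add_zero] at this
    exact this
  have n02 := hno' _ _ _ a01 a12
  have n13 := hno' _ _ _ a12 a23
  have n50 : ¬ G.Adj (e 5) (e 0) := hr.1
  have n52 : ¬ G.Adj (e 5) (e 2) := hr.2
  clear_value e
  let f0 : Fin 6 → ℕ := ![0, 1, 0, 1, 2, 0]
  refine core6 G hchi e (fun x => f0 (e.symm x)) ![0, 0, 0, 1, 1, 2] ?_ ?_ ?_ ?_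
  · intro x y hxy
    obtain ⟨i, rfl⟩ := e.surjective x
    obtain ⟨j, rfl⟩ := e.surjective y
    simp only [Equiv.symm_apply_apply]
    have hxy' := hxy.symm
    have hne := hxy.ne
    fin_cases i <;> fin_cases j <;> simp [f0] at hne hxy hxy' ⊢ <;> tauto
  · intro x
    generalize e.symm x = i
    revert i
    decide
  · simp only [Equiv.symm_apply_apply]
    decide
  · intro d hd hs
    rw [eta6 d] at hs ⊢
    exact dec_cycle _ _ _ _ _ _ (hd _ _ a01) (hd _ _ a12) (hd _ _ a23) (hd _ _ a34)
      (hd _ _ a40) hs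

set_option synthInstance.maxHeartbeats 400000 in
set_option synthInstance.maxSize 2048 in
set_option maxHeartbeats 1000000 in
theorem dec_two : ∀ a b c d e f : Fin 3, a ≠ b → a ≠ c → b ≠ c → d ≠ e → d ≠ f → e ≠ f →
    (∀ k, (univ.filter fun i => ![0, 0, 1, 1, 2, 2] i = k).card =
      (univ.filter fun i => ![a, b, c, d, e, f] i = k).card) := by
  decide +kernel

/-- A triangle with one cross edge; both halves rainbow. -/
theorem case_cross (G : SimpleGraph V) (hchi : chromNum G = 3) (e : Fin 6 ≃ V) (f : V → ℕ)
    (hf : IsProperColoring G f) (hf3 : ∀ v, f v < 3)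
    (a01 : G.Adj (e 0) (e 1)) (a02 : G.Adj (e 0) (e 2)) (a12 : G.Adj (e 1) (e 2))
    (a23 : G.Adj (e 2) (e 3)) (h34 : f (e 3) ≠ f (e 4)) (h35 : f (e 3) ≠ f (e 5))
    (h45 : f (e 4) ≠ f (e 5)) : 3 ≤ villainy G := by
  refine core6 G hchi e f ![0, 0, 1, 1, 2, 2] hf hf3 ?_ ?_
  · let d : Fin 6 → Fin 3 := fun i => ⟨f (e i), hf3 _⟩
    have hd : ∀ i j, f (e i) ≠ f (e j) → d i ≠ d j := by
      intro i j h h'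
      exact h (by simpa [d] using h')
    intro k
    rw [dec_two _ _ _ _ _ _ (hd _ _ (hf a01)) (hd _ _ (hf a02)) (hd _ _ (hf a12))
      (hd _ _ h34) (hd _ _ h35) (hd _ _ h45), ← eta6 d]
    simp [d, Fin.ext_iff]
  · intro d hd hs
    rw [eta6 d] at hs ⊢
    exact dec_prism _ _ _ _ _ _ (hd _ _ a01) (hd _ _ a02) (hd _ _ a12) (hd _ _ a23) hs

theorem exists_third : ∀ i : Fin 3, ∃ σ : Equiv.Perm (Fin 3), σ 2 = i := fun i =>
  ⟨Equiv.swap 2 i, by simp⟩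

/-- The triangle case. -/
theorem case_triangle (G : SimpleGraph V) (hchi : chromNum G = 3) (f : V → ℕ)
    (hf : IsProperColoring G f) (hf3 : ∀ v, f v < 3)
    (hnot : ¬ Nonempty (G ≃g ((⊤ : SimpleGraph (Fin 3)) ⊕g (⊤ : SimpleGraph (Fin 3)))))
    (s : Fin 3 ⊕ Fin 3 ≃ V) (hT : ∀ i j, i ≠ j → G.Adj (s (.inl i)) (s (.inl j))) :
    3 ≤ villainy G := by
  have hfT : ∀ i j, i ≠ j → f (s (.inl i)) ≠ f (s (.inl j)) := fun i j h => hf (hT i j h)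
  by_cases hU : ∀ i j, i ≠ j → f (s (.inr i)) ≠ f (s (.inr j))
  · by_cases hX : ∃ i j, G.Adj (s (.inl i)) (s (.inr j))
    · obtain ⟨i, j, hij⟩ := hX
      obtain ⟨σ, hσ⟩ := exists_third i
      obtain ⟨τ, hτ⟩ : ∃ τ : Equiv.Perm (Fin 3), τ 0 = j := ⟨Equiv.swap 0 j, by simp⟩
      let e : Fin 6 ≃ V := (finSumFinEquiv (m := 3) (n := 3)).symm.trans
        ((Equiv.sumCongr σ τ).trans s)
      have e0 : e 0 = s (.inl (σ 0)) := rfl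
      have e1 : e 1 = s (.inl (σ 1)) := rfl
      have e2 : e 2 = s (.inl (σ 2)) := rfl
      have e3 : e 3 = s (.inr (τ 0)) := rfl
      have e4 : e 4 = s (.inr (τ 1)) := rfl
      have e5 : e 5 = s (.inr (τ 2)) := rfl
      refine case_cross G hchi e f hf hf3 ?_ ?_ ?_ ?_ ?_ ?_ ?_
      · rw [e0, e1]; exact hT _ _ (σ.injective.ne (by decide))
      · rw [e0, e2]; exact hT _ _ (σ.injective.ne (by decide))
      · rw [e1, e2]; exact hT _ _ (σ.injective.ne (by decide))
      · rw [e2, e3, hσ, hτ]; exact hij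
      · rw [e3, e4]; exact hU _ _ (τ.injective.ne (by decide))
      · rw [e3, e5]; exact hU _ _ (τ.injective.ne (by decide))
      · rw [e4, e5]; exact hU _ _ (τ.injective.ne (by decide))
    · push Not at hX
      have hX' : ∀ i j, ¬ G.Adj (s (.inr i)) (s (.inl j)) := fun i j h => hX j i h.symm
      by_cases hE : ∀ i j, i ≠ j → G.Adj (s (.inr i)) (s (.inr j))
      · exfalso
        apply hnot
        refine ⟨⟨s.symm, ?_⟩⟩
        intro x y
        obtain ⟨i, rfl⟩ := s.surjective x
        obtain ⟨j, rfl⟩ := s.surjective y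
        simp only [Equiv.symm_apply_apply]
        rcases i with i | i <;> rcases j with j | j
        · simp only [SimpleGraph.sum_adj, SimpleGraph.top_adj]
          exact ⟨hT i j, fun h => fun h' => h.ne (by rw [h'])⟩
        · simp [hX]
        · simp [hX']
        · simp only [SimpleGraph.sum_adj, SimpleGraph.top_adj]
          exact ⟨hE i j, fun h => fun h' => h.ne (by rw [h'])⟩
      · push Not at hE
        obtain ⟨i, j, hij, hn⟩ := hE
        have hn' : ¬ G.Adj (s (.inr j)) (s (.inr i)) := fun h => hn h.symm
        let g : Fin 3 ⊕ Fin 3 → ℕ := Sum.elim (fun k => (k : ℕ))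
          (fun k => if k = i ∨ k = j then 0 else 1)
        refine case_big G hchi (fun x => g (s.symm x)) ?_ ?_ (fun k => s (.inl k))
          ![s (.inl 0), s (.inr i), s (.inr j)] hT ?_ 0 ?_
        · intro x y hxy
          obtain ⟨a, rfl⟩ := s.surjective x
          obtain ⟨b, rfl⟩ := s.surjective y
          simp only [Equiv.symm_apply_apply]
          rcases a with a | a <;> rcases b with b | b
          · intro h
            exact hxy.ne (by rw [Fin.ext h])
          · exact absurd hxy (hX _ _)
          · exact absurd hxy (hX' _ _)
          · have hab : a ≠ b := fun h => hxy.ne (by rw [h])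
            simp only [g, Sum.elim_inr]
            have h1 : ¬ (a = i ∧ b = j) := by rintro ⟨rfl, rfl⟩; exact hn hxy
            have h2 : ¬ (a = j ∧ b = i) := by rintro ⟨rfl, rfl⟩; exact hn' hxy
            clear hxy
            clear hn hn' 
            clear_value g
            revert a b i j
            decide
        · intro x
          generalize s.symm x = a
          rcases a with a | a
          · exact a.2
          · simp only [g, Sum.elim_inr]; split_ifs <;> omega
        · intro a b hab
          fin_cases a <;> fin_cases b <;> simp [hij, hij.symm] at hab ⊢
        · intro a
          fin_cases a <;> simp [g]
  · push Not at hU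
    obtain ⟨i, j, hij, hfij⟩ := hU
    obtain ⟨k, hk⟩ : ∃ k, f (s (.inl k)) = f (s (.inr i)) := by
      let d : Fin 3 → Fin 3 := fun k => ⟨f (s (.inl k)), hf3 _⟩
      have : Function.Injective d := by
        intro a b hab
        by_contra hne
        exact hfT a b hne (by simpa [d] using hab)
      obtain ⟨k, hk⟩ := (Finite.surjective_of_injective this) ⟨f (s (.inr i)), hf3 _⟩
      exact ⟨k, by simpa [d] using hk⟩
    refine case_big G hchi f hf hf3 (fun k => s (.inl k))
      ![s (.inl k), s (.inr i), s (.inr j)] hT ?_ (f (s (.inr i))) ?_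
    · intro a b hab
      fin_cases a <;> fin_cases b <;> simp [hij, hij.symm] at hab ⊢
    · intro a
      fin_cases a <;> simp [hk, hfij]

theorem villainy_ge_three_of_order_six (G : SimpleGraph V)
    (hn : Fintype.card V = 6) (hchi : chromNum G = 3)
    (hnot : ¬ Nonempty (G ≃g ((⊤ : SimpleGraph (Fin 3)) ⊕g (⊤ : SimpleGraph (Fin 3))))) :
    3 ≤ villainy G := by
  have hchi' : G.chromaticNumber = 3 := by
    have h := hchi
    unfold chromNum at h
    have hne : G.chromaticNumber ≠ ⊤ := by
      intro h'
      rw [h'] at h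
      simp at h
    rw [← ENat.natCast_toNat hne, h]
    rfl
  have h2 : ¬ G.Colorable 2 := by
    intro h
    have := h.chromaticNumber_le
    rw [hchi'] at this
    exact absurd this (by decide)
  by_cases hT : ∃ a b c, G.Adj a b ∧ G.Adj a c ∧ G.Adj b c
  · obtain ⟨a, b, c, hab, hac, hbc⟩ := hT
    have h3 : G.Colorable 3 := by
      apply SimpleGraph.chromaticNumber_le_iff_colorable.mp
      rw [hchi']
      rfl
    obtain ⟨C⟩ := h3
    let t : Fin 3 → V := ![a, b, c]
    have hTadj : ∀ i j, i ≠ j → G.Adj (t i) (t j) := by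
      intro i j hij
      fin_cases i <;> fin_cases j <;> simp [t, hab, hac, hbc, hab.symm, hac.symm, hbc.symm] at hij ⊢
    have hti : Function.Injective t := by
      intro i j hij
      by_contra hne
      exact (hTadj i j hne).ne hij
    have s0 : Fin 3 ⊕ Fin 3 ≃ V := Fintype.equivOfCardEq (by simp [hn])
    obtain ⟨σ, hσ⟩ := Equiv.Perm.exists_extending_pair (fun i => s0 (.inl i)) t
      (s0.injective.comp Sum.inl_injective) hti
    refine case_triangle G hchi (fun v => (C v : ℕ)) ?_ (fun v => (C v).2) hnot (s0.trans σ) ?_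
    · intro u v huv h
      exact C.valid huv (Fin.ext h)
    · intro i j hij
      simp only [Equiv.trans_apply]
      rw [hσ, hσ]
      exact hTadj i j hij
  · rcases exists_odd G hn h2 with h | ⟨v, hv, hadj⟩
    · exact absurd h hT
    · exact case_cycle G hn hchi hT v hv hadj
end

section
/- If G is a graph of order at most 5 with χ(G) = 3, then B(G) ≥ 3 unless G is one of: C_3, C_5, C_3 + K_2 (disjoint union of a triangle and an edge), C_3 + K_1 (triangle plus an isolated vertex), or a triangle with a pendant edge. -/
open Finset

variable {V : Type*}

variable [Fintype V] [DecidableEq V]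

/-- The paw: a triangle `0 1 2` with a pendant edge `2 3`. -/
def pawGraph : SimpleGraph (Fin 4) :=
  SimpleGraph.fromRel fun a b =>
    (a = 0 ∧ b = 1) ∨ (a = 1 ∧ b = 2) ∨ (a = 0 ∧ b = 2) ∨ (a = 2 ∧ b = 3)

/-! Boolean checks on adjacency matrices over `Fin n`. -/

def allB (f : Bool → Bool) : Bool := f true && f false

theorem allB_spec {f : Bool → Bool} (h : allB f = true) (b : Bool) : f b = true := by
  unfold allB at h
  cases b <;> simp_all

def propB {n : ℕ} (L : List (Fin n × Fin n)) (A : Fin n → Fin n → Bool) (c : Fin n → ℕ) : Bool :=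
  L.all fun p => !(A p.1 p.2 && Nat.beq (c p.1) (c p.2))

def twoB {n : ℕ} (L : List (Fin n × Fin n)) (T : List (Fin n → ℕ))
    (A : Fin n → Fin n → Bool) : Bool :=
  T.any fun c => propB L A c

def k4B {n : ℕ} (Q : List (Fin 4 → Fin n)) (A : Fin n → Fin n → Bool) : Bool :=
  Q.any fun q => A (q 0) (q 1) && A (q 0) (q 2) && A (q 0) (q 3) && A (q 1) (q 2)
    && A (q 1) (q 3) && A (q 2) (q 3)

def swp {n : ℕ} (p : Fin n × Fin n) (c : Fin n → ℕ) : Fin n → ℕ :=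
  fun i => cond (Nat.beq i p.1) (c p.2) (cond (Nat.beq i p.2) (c p.1) (c i))

def certB {n : ℕ} (L : List (Fin n × Fin n)) (Gs : List (List (Fin n → ℕ)))
    (A : Fin n → Fin n → Bool) : Bool :=
  Gs.any fun g => (g.any fun f => propB L A f) &&
    g.any fun c => !(propB L A c) && L.all fun p => !(propB L A (swp p c))

def isoB {n : ℕ} (L : List (Fin n × Fin n)) (P : List (Fin n → Fin n))
    (H : Fin n → Fin n → Bool) (A : Fin n → Fin n → Bool) : Bool :=
  P.any fun q => L.all fun p => A (q p.1) (q p.2) == H p.1 p.2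

def pairs3 : List (Fin 3 × Fin 3) :=
  [(0,1), (0,2), (1,2)]

def two3 : List (Fin 3 → ℕ) :=
  [![0,0,0], ![0,0,1], ![0,1,0], ![0,1,1]]

def quads3 : List (Fin 4 → Fin 3) :=
  []

def groups3 : List (List (Fin 3 → ℕ)) :=
  []

def pairs4 : List (Fin 4 × Fin 4) :=
  [(0,1), (0,2), (0,3), (1,2), (1,3), (2,3)]

def two4 : List (Fin 4 → ℕ) :=
  [![0,0,0,0], ![0,0,0,1], ![0,0,1,0], ![0,0,1,1], ![0,1,0,0], ![0,1,0,1], ![0,1,1,0], ![0,1,1,1]]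

def quads4 : List (Fin 4 → Fin 4) :=
  [![0,1,2,3]]

def groups4 : List (List (Fin 4 → ℕ)) :=
  [[![0,0,1,2], ![0,1,0,2], ![0,1,2,0], ![1,0,0,2], ![1,0,2,0], ![1,2,0,0]]]

def pairs5 : List (Fin 5 × Fin 5) :=
  [(0,1), (0,2), (0,3), (0,4), (1,2), (1,3), (1,4), (2,3), (2,4), (3,4)]

def two5 : List (Fin 5 → ℕ) :=
  [![0,0,0,0,0], ![0,0,0,0,1], ![0,0,0,1,0], ![0,0,0,1,1], ![0,0,1,0,0], ![0,0,1,0,1], ![0,0,1,1,0], ![0,0,1,1,1], ![0,1,0,0,0], ![0,1,0,0,1], ![0,1,0,1,0], ![0,1,0,1,1], ![0,1,1,0,0], ![0,1,1,0,1], ![0,1,1,1,0], ![0,1,1,1,1]]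

def quads5 : List (Fin 4 → Fin 5) :=
  [![0,1,2,3], ![0,1,2,4], ![0,1,3,4], ![0,2,3,4], ![1,2,3,4]]

def groups5 : List (List (Fin 5 → ℕ)) :=
  [[![0,0,0,1,2], ![0,0,1,0,2], ![0,0,1,2,0], ![0,1,0,0,2], ![0,1,0,2,0], ![0,1,2,0,0], ![1,0,0,0,2], ![1,0,0,2,0], ![1,0,2,0,0], ![1,2,0,0,0]],
   [![0,0,1,1,2], ![0,0,1,2,1], ![0,0,2,1,1], ![0,1,0,1,2], ![0,1,0,2,1], ![0,1,1,0,2], ![0,1,1,2,0], ![0,1,2,0,1], ![0,1,2,1,0], ![0,2,0,1,1], ![0,2,1,0,1], ![0,2,1,1,0], ![2,0,0,1,1], ![2,0,1,0,1], ![2,0,1,1,0]]]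

def permC3 : List (Fin 3 → Fin 3) :=
  [![0,1,2]]

def adjC3 : Fin 3 → Fin 3 → Bool :=
  ![![false,true,true],![true,false,true],![true,true,false]]

def permC5 : List (Fin 5 → Fin 5) :=
  [![0,1,2,3,4], ![0,1,2,4,3], ![0,1,3,2,4], ![0,1,3,4,2], ![0,1,4,2,3], ![0,1,4,3,2], ![0,2,1,3,4], ![0,2,1,4,3], ![0,2,3,1,4], ![0,2,4,1,3], ![0,3,1,2,4], ![0,3,2,1,4]]

def adjC5 : Fin 5 → Fin 5 → Bool :=
  ![![false,true,false,false,true],![true,false,true,false,false],![false,true,false,true,false],![false,false,true,false,true],![true,false,false,true,false]]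

def permT2 : List (Fin 5 → Fin 5) :=
  [![0,1,2,3,4], ![0,1,3,2,4], ![0,1,4,2,3], ![0,2,3,1,4], ![0,2,4,1,3], ![0,3,4,1,2], ![1,2,3,0,4], ![1,2,4,0,3], ![1,3,4,0,2], ![2,3,4,0,1]]

def adjT2 : Fin 5 → Fin 5 → Bool :=
  ![![false,true,true,false,false],![true,false,true,false,false],![true,true,false,false,false],![false,false,false,false,true],![false,false,false,true,false]]

def permT1 : List (Fin 4 → Fin 4) :=
  [![0,1,2,3], ![0,1,3,2], ![0,2,3,1], ![1,2,3,0]]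

def adjT1 : Fin 4 → Fin 4 → Bool :=
  ![![false,true,true,false],![true,false,true,false],![true,true,false,false],![false,false,false,false]]

def permPaw : List (Fin 4 → Fin 4) :=
  [![0,1,2,3], ![0,1,3,2], ![0,2,1,3], ![0,2,3,1], ![0,3,1,2], ![0,3,2,1], ![1,2,0,3], ![1,2,3,0], ![1,3,0,2], ![1,3,2,0], ![2,3,0,1], ![2,3,1,0]]

def adjPaw : Fin 4 → Fin 4 → Bool :=
  ![![false,true,true,false],![true,false,true,false],![true,true,false,true],![false,false,true,false]]

def mk4 (b01 b02 b03 b12 b13 b23 : Bool) : Fin 4 → Fin 4 → Bool :=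
  ![![false,b01,b02,b03],![b01,false,b12,b13],![b02,b12,false,b23],![b03,b13,b23,false]]

def chk4 (A : Fin 4 → Fin 4 → Bool) : Bool :=
  twoB pairs4 two4 A || (k4B quads4 A || (certB pairs4 groups4 A || (isoB pairs4 permT1 adjT1 A || isoB pairs4 permPaw adjPaw A)))

set_option maxRecDepth 100000 in
theorem all4 : (allB fun b01 => allB fun b02 => allB fun b03 => allB fun b12 => allB fun b13 => allB fun b23 =>
    chk4 (mk4 b01 b02 b03 b12 b13 b23)) = true := by
  decide +kernel

def mk5 (b01 b02 b03 b04 b12 b13 b14 b23 b24 b34 : Bool) : Fin 5 → Fin 5 → Bool :=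
  ![![false,b01,b02,b03,b04],![b01,false,b12,b13,b14],![b02,b12,false,b23,b24],![b03,b13,b23,false,b34],![b04,b14,b24,b34,false]]

def chk5 (A : Fin 5 → Fin 5 → Bool) : Bool :=
  twoB pairs5 two5 A || (k4B quads5 A || (certB pairs5 groups5 A || (isoB pairs5 permC5 adjC5 A || isoB pairs5 permT2 adjT2 A)))

set_option maxRecDepth 100000 in
theorem all5 : (allB fun b01 => allB fun b02 => allB fun b03 => allB fun b04 => allB fun b12 => allB fun b13 => allB fun b14 => allB fun b23 => allB fun b24 => allB fun b34 =>
    chk5 (mk5 b01 b02 b03 b04 b12 b13 b14 b23 b24 b34)) = true := by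
  decide +kernel

def mk3 (b01 b02 b12 : Bool) : Fin 3 → Fin 3 → Bool :=
  ![![false,b01,b02],![b01,false,b12],![b02,b12,false]]

def chk3 (A : Fin 3 → Fin 3 → Bool) : Bool :=
  twoB pairs3 two3 A || (k4B quads3 A || (certB pairs3 groups3 A || isoB pairs3 permC3 adjC3 A))

set_option maxRecDepth 100000 in
theorem all3 : (allB fun b01 => allB fun b02 => allB fun b12 =>
    chk3 (mk3 b01 b02 b12)) = true := by
  decide +kernel

set_option linter.unusedSectionVars false

/-! Soundness of the checks. -/

theorem le_villainy {G : SimpleGraph V} {f c : V → ℕ} (hf : IsOptimalColoring G f)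
    (hc : IsPermutationOf c f)
    (h : ∀ c', IsProperColoring G c' → SameColorCounts c c' → 3 ≤ recolorCount c c') :
    3 ≤ villainy G := by
  have key : ∀ f c : V → ℕ, IsOptimalColoring G f → IsPermutationOf c f →
      SameColorCounts c f := by
    rintro f c - ⟨σ, rfl⟩ k
    apply Finset.card_bij (fun a _ => σ a)
    · intro a ha
      simpa using ha
    · intro a _ b _ hab
      exact σ.injective hab
    · intro b hb
      exact ⟨σ.symm b, by simpa using hb, by simp⟩
  have hle : colVillainy G c ≤ villainy G := by
    apply le_csSup
    · refine ⟨Fintype.card V, ?_⟩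
      rintro n ⟨f, c, hf, hc, rfl⟩
      have hmem : recolorCount c f ∈ {n | ∃ c', IsProperColoring G c' ∧ SameColorCounts c c' ∧
          recolorCount c c' = n} := ⟨f, hf.1, key f c hf hc, rfl⟩
      exact (Nat.sInf_le hmem).trans (Finset.card_le_univ _)
    · exact ⟨f, c, hf, hc, rfl⟩
  refine le_trans ?_ hle
  apply le_csInf
  · exact ⟨_, f, hf.1, key f c hf hc, rfl⟩
  · rintro n ⟨c', h1, h2, rfl⟩
    exact h c' h1 h2

theorem recolor_small {c c' : V → ℕ} (hs : SameColorCounts c c') (h : recolorCount c c' < 3) :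
    c' = c ∨ ∃ u v, u ≠ v ∧ c' u = c v ∧ c' v = c u ∧ ∀ w, w ≠ u → w ≠ v → c' w = c w := by
  classical
  by_cases hcc : c' = c
  · exact Or.inl hcc
  right
  obtain ⟨u, hu⟩ : ∃ u, c u ≠ c' u := by
    by_contra hne
    push Not at hne
    exact hcc (funext fun x => (hne x).symm)
  -- a vertex receiving color `c u`
  have hex : ∀ u, c u ≠ c' u → ∃ v, c v ≠ c u ∧ c' v = c u := by
    intro u hu
    by_contra hne
    push Not at hne
    have hss : (univ.filter fun v => c' v = c u) ⊂ (univ.filter fun v => c v = c u) := by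
      rw [Finset.ssubset_iff_of_subset]
      · exact ⟨u, by simp, by simpa using fun h => hu h.symm⟩
      · intro x hx
        simp only [mem_filter, mem_univ, true_and] at hx ⊢
        by_contra hxu
        exact hne x hxu hx
    have := Finset.card_lt_card hss
    have := hs (c u)
    omega
  obtain ⟨v, hv1, hv2⟩ := hex u hu
  have huv : u ≠ v := by rintro rfl; exact hv1 rfl
  have hv : c v ≠ c' v := by rw [hv2]; exact hv1
  have hD : ∀ w, w ≠ u → w ≠ v → c' w = c w := by
    intro w hwu hwv
    by_contra hw
    have h3 : ({u, v, w} : Finset V) ⊆ univ.filter fun v => c v ≠ c' v := by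
      intro x hx
      simp only [mem_insert, mem_singleton] at hx
      simp only [mem_filter, mem_univ, true_and]
      rcases hx with rfl | rfl | rfl
      · exact hu
      · exact hv
      · exact fun h => hw h.symm
    have := Finset.card_le_card h3
    rw [Finset.card_eq_three.mpr ⟨u, v, w, huv, hwu.symm, hwv.symm, rfl⟩] at this
    unfold recolorCount at h
    omega
  refine ⟨u, v, huv, ?_, hv2, hD⟩
  obtain ⟨w, hw1, hw2⟩ := hex v hv
  by_cases h1 : w = u
  · rw [← h1]; exact hw2
  · by_cases h2 : w = v
    · subst h2; exact absurd rfl hw1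
    · rw [hD w h1 h2] at hw2
      exact absurd hw2 hw1

theorem perm_of_counts {n : ℕ} {f c : Fin n → ℕ}
    (h : ∀ k, (univ.filter fun v => c v = k).card = (univ.filter fun v => f v = k).card) :
    ∃ σ : Equiv.Perm (Fin n), c = f ∘ σ := by
  have e : ∀ k, {a // c a = k} ≃ {a // f a = k} := fun k =>
    Fintype.equivOfCardEq (by rw [Fintype.card_subtype, Fintype.card_subtype, h k])
  refine ⟨Equiv.ofFiberEquiv e, ?_⟩
  funext a
  exact (Equiv.ofFiberEquiv_map e a).symm

def PairsOk {n : ℕ} (L : List (Fin n × Fin n)) : Prop :=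
  (∀ i j : Fin n, i ≠ j → (i, j) ∈ L ∨ (j, i) ∈ L)

def GoodGroup {n : ℕ} (g : List (Fin n → ℕ)) : Prop :=
  (∀ f ∈ g, univ.image f = {0, 1, 2}) ∧ ∀ f ∈ g, ∀ c ∈ g, ∀ k < 3,
    (univ.filter fun v => c v = k).card = (univ.filter fun v => f v = k).card

theorem GoodGroup.perm {n : ℕ} {g : List (Fin n → ℕ)} (hg : GoodGroup g) {f c : Fin n → ℕ}
    (hf : f ∈ g) (hc : c ∈ g) : ∃ σ : Equiv.Perm (Fin n), c = f ∘ σ := by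
  apply perm_of_counts
  intro k
  by_cases hk : k < 3
  · exact hg.2 f hf c hc k hk
  · have h0 : ∀ f ∈ g, (univ.filter fun v => f v = k).card = 0 := by
      intro f hf
      rw [Finset.card_eq_zero, Finset.filter_eq_empty_iff]
      intro x _ hx
      have := Finset.mem_image_of_mem f (Finset.mem_univ x)
      rw [hg.1 f hf] at this
      simp only [mem_insert, mem_singleton] at this
      omega
    rw [h0 f hf, h0 c hc]

theorem nbeq_false {a b : ℕ} (h : a ≠ b) : Nat.beq a b = false := by
  cases hb : Nat.beq a b
  · rfl
  · exact absurd (Nat.eq_of_beq_eq_true hb) h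

section Sound

variable {n : ℕ} {G : SimpleGraph V} {e : V ≃ Fin n} {A : Fin n → Fin n → Bool}
  {L : List (Fin n × Fin n)}

def AdjRep (G : SimpleGraph V) (e : V ≃ Fin n) (A : Fin n → Fin n → Bool) : Prop :=
  ∀ u v, A (e u) (e v) = true ↔ G.Adj u v

theorem propB_iff (hA : AdjRep G e A) (hL : PairsOk L) (c : Fin n → ℕ) :
    propB L A c = true ↔ IsProperColoring G (c ∘ e) := by
  constructor
  · intro h u v huv hc
    unfold propB at h
    rw [List.all_eq_true] at h
    rcases hL (e u) (e v) (fun h => huv.ne (e.injective h)) with h1 | h1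
    · have := h _ h1
      have hh := (hA u v).2 huv
      simp_all
    · have := h _ h1
      have hh := (hA v u).2 huv.symm
      simp_all
  · intro h
    unfold propB
    rw [List.all_eq_true]
    rintro ⟨i, j⟩ -
    have := @h (e.symm i) (e.symm j)
    have hh := hA (e.symm i) (e.symm j)
    simp only [Equiv.apply_symm_apply, Function.comp] at this hh
    rw [← hh] at this
    cases hij : A i j
    · simp [hij]
    · simp [nbeq_false (this hij)]

theorem chrom_eq (hchi : chromNum G = 3) : G.chromaticNumber = 3 := by
  unfold chromNum at hchi
  have : G.chromaticNumber ≠ ⊤ := by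
    intro h
    rw [h] at hchi
    simp at hchi
  rw [← ENat.natCast_toNat this, hchi]
  rfl

theorem not_two (hchi : chromNum G = 3) : ¬ G.Colorable 2 := by
  intro h
  have := h.chromaticNumber_le
  rw [chrom_eq hchi] at this
  exact absurd this (by decide)

theorem twoB_sound (hchi : chromNum G = 3) (hA : AdjRep G e A) (hL : PairsOk L)
    {T : List (Fin n → ℕ)} (hT : ∀ c ∈ T, ∀ i, c i < 2) : twoB L T A ≠ true := by
  intro h
  unfold twoB at h
  rw [List.any_eq_true] at h
  obtain ⟨c, hc, hp⟩ := h
  have hp := (propB_iff hA hL c).1 hp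
  apply not_two hchi
  refine ⟨SimpleGraph.Coloring.mk (fun v => (⟨c (e v), hT c hc _⟩ : Fin 2)) ?_⟩
  intro u v huv heq
  exact hp huv (by simpa using heq)

theorem k4B_sound (hchi : chromNum G = 3) (hA : AdjRep G e A)
    {Q : List (Fin 4 → Fin n)} : k4B Q A ≠ true := by
  intro h
  unfold k4B at h
  rw [List.any_eq_true] at h
  obtain ⟨q, -, hq⟩ := h
  have hA' : ∀ i j, A i j = true → G.Adj (e.symm i) (e.symm j) := by
    intro i j hij
    rw [← hA]; simpa using hij
  simp only [Bool.and_eq_true] at hq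
  obtain ⟨⟨⟨⟨⟨h1, h2⟩, h3⟩, h4⟩, h5⟩, h6⟩ := hq
  have hcol : G.Colorable 3 := by
    rw [← SimpleGraph.chromaticNumber_le_iff_colorable, chrom_eq hchi]
    exact le_rfl
  obtain ⟨C⟩ := hcol
  have g1 := C.valid (hA' _ _ h1)
  have g2 := C.valid (hA' _ _ h2)
  have g3 := C.valid (hA' _ _ h3)
  have g4 := C.valid (hA' _ _ h4)
  have g5 := C.valid (hA' _ _ h5)
  have g6 := C.valid (hA' _ _ h6)
  omega

theorem certB_sound (hchi : chromNum G = 3) (hA : AdjRep G e A) (hL : PairsOk L)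
    {Gs : List (List (Fin n → ℕ))} (hG : ∀ g ∈ Gs, GoodGroup g) (h : certB L Gs A = true) :
    3 ≤ villainy G := by
  unfold certB at h
  rw [List.any_eq_true] at h
  obtain ⟨g, hg, h⟩ := h
  rw [Bool.and_eq_true, List.any_eq_true, List.any_eq_true] at h
  obtain ⟨⟨f, hf, hfp⟩, c, hc, hcp⟩ := h
  rw [Bool.and_eq_true, List.all_eq_true] at hcp
  obtain ⟨hc1, hc2⟩ := hcp
  have hgood := hG g hg
  obtain ⟨σ, hσ⟩ := hgood.perm hf hc
  apply le_villainy (f := f ∘ e) (c := c ∘ e)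
  · refine ⟨(propB_iff hA hL f).1 hfp, ?_⟩
    rw [hchi, ← Finset.image_image, Finset.image_univ_equiv, hgood.1 f hf]
    rfl
  · refine ⟨(e.trans σ).trans e.symm, ?_⟩
    funext v
    simp [hσ]
  · intro c' hp' hs
    by_contra hlt
    rcases recolor_small hs (by omega) with h | ⟨u, v, huv, h1, h2, h3⟩
    · rw [h] at hp'
      rw [(propB_iff hA hL c).2 hp'] at hc1
      simp at hc1
    · have hsw : ∀ p : Fin n × Fin n, (p = (e u, e v) ∨ p = (e v, e u)) →
          c' = swp p c ∘ e := by
        have hne : e u ≠ e v := fun h => huv (e.injective h)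
        rintro p hp
        funext w
        simp only [Function.comp, swp]
        by_cases hwu : w = u
        · subst hwu
          rcases hp with rfl | rfl
          · simp [h1]
          · simp [h1, nbeq_false (Fin.val_ne_of_ne hne)]
        by_cases hwv : w = v
        · subst hwv
          rcases hp with rfl | rfl
          · simp [h2, nbeq_false (Fin.val_ne_of_ne hne.symm)]
          · simp [h2]
        rw [h3 w hwu hwv]
        rcases hp with rfl | rfl <;>
          simp [nbeq_false (Fin.val_ne_of_ne (fun h => hwu (e.injective h) : e w ≠ e u)),
            nbeq_false (Fin.val_ne_of_ne (fun h => hwv (e.injective h) : e w ≠ e v))]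
      obtain ⟨p, hp, hpL⟩ : ∃ p, (p = (e u, e v) ∨ p = (e v, e u)) ∧ p ∈ L := by
        rcases hL (e u) (e v) (fun h => huv (e.injective h)) with h | h
        · exact ⟨_, Or.inl rfl, h⟩
        · exact ⟨_, Or.inr rfl, h⟩
      have := hc2 p hpL
      rw [hsw p hp] at hp'
      rw [(propB_iff hA hL _).2 hp'] at this
      simp at this

theorem isoB_sound {W : Type*} {H : SimpleGraph W} {e' : W ≃ Fin n} {B : Fin n → Fin n → Bool}
    (hA : AdjRep G e A) (hB : AdjRep H e' B) (hL : PairsOk L)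
    {P : List (Fin n → Fin n)} (hP : ∀ q ∈ P, Function.Injective q) (h : isoB L P B A = true) :
    Nonempty (G ≃g H) := by
  unfold isoB at h
  rw [List.any_eq_true] at h
  obtain ⟨q, hq, h⟩ := h
  rw [List.all_eq_true] at h
  have hbij : Function.Bijective q := Finite.injective_iff_bijective.1 (hP q hq)
  have key : ∀ w w', G.Adj (e.symm (q (e' w))) (e.symm (q (e' w'))) ↔ H.Adj w w' := by
    intro w w'
    by_cases hw : w = w'
    · subst hw; simp
    rcases hL (e' w) (e' w') (fun h => hw (e'.injective h)) with h1 | h1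
    · have := h _ h1
      simp only [beq_iff_eq] at this
      rw [← hA, ← hB, ← this]; simp
    · have := h _ h1
      simp only [beq_iff_eq] at this
      rw [G.adj_comm, H.adj_comm, ← hA, ← hB, ← this]; simp
  let φ : H ≃g G := ⟨(e'.trans (Equiv.ofBijective q hbij)).trans e.symm, by
    intro w w'
    exact key w w'⟩
  exact ⟨φ.symm⟩

end Sound

theorem pairsOk3 : PairsOk pairs3 := by
  unfold PairsOk
  decide

theorem two_ok3 : ∀ c ∈ two3, ∀ i, c i < 2 := by
  decide

theorem groups_ok3 : ∀ g ∈ groups3, GoodGroup g := by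
  unfold GoodGroup
  decide +kernel

theorem chk_true3 (A : Fin 3 → Fin 3 → Bool) (hs : ∀ i j, A i j = A j i)
    (hi : ∀ i, A i i = false) : chk3 A = true := by
  have h := allB_spec (allB_spec (allB_spec (all3) (A 0 1)) (A 0 2)) (A 1 2)
  have hA : A = mk3 (A 0 1) (A 0 2) (A 1 2) := by
    funext i j
    fin_cases i <;> fin_cases j <;>
      first
      | exact hi _
      | rfl
      | exact hs _ _
  rw [hA]
  exact h

theorem pairsOk4 : PairsOk pairs4 := by
  unfold PairsOk
  decide

theorem two_ok4 : ∀ c ∈ two4, ∀ i, c i < 2 := by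
  decide

theorem groups_ok4 : ∀ g ∈ groups4, GoodGroup g := by
  unfold GoodGroup
  decide +kernel

theorem chk_true4 (A : Fin 4 → Fin 4 → Bool) (hs : ∀ i j, A i j = A j i)
    (hi : ∀ i, A i i = false) : chk4 A = true := by
  have h := allB_spec (allB_spec (allB_spec (allB_spec (allB_spec (allB_spec (all4) (A 0 1)) (A 0 2)) (A 0 3)) (A 1 2)) (A 1 3)) (A 2 3)
  have hA : A = mk4 (A 0 1) (A 0 2) (A 0 3) (A 1 2) (A 1 3) (A 2 3) := by
    funext i j
    fin_cases i <;> fin_cases j <;>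
      first
      | exact hi _
      | rfl
      | exact hs _ _
  rw [hA]
  exact h

theorem pairsOk5 : PairsOk pairs5 := by
  unfold PairsOk
  decide

theorem two_ok5 : ∀ c ∈ two5, ∀ i, c i < 2 := by
  decide

theorem groups_ok5 : ∀ g ∈ groups5, GoodGroup g := by
  unfold GoodGroup
  decide +kernel

theorem chk_true5 (A : Fin 5 → Fin 5 → Bool) (hs : ∀ i j, A i j = A j i)
    (hi : ∀ i, A i i = false) : chk5 A = true := by
  have h := allB_spec (allB_spec (allB_spec (allB_spec (allB_spec (allB_spec (allB_spec (allB_spec (allB_spec (allB_spec (all5) (A 0 1)) (A 0 2)) (A 0 3)) (A 0 4)) (A 1 2)) (A 1 3)) (A 1 4)) (A 2 3)) (A 2 4)) (A 3 4)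
  have hA : A = mk5 (A 0 1) (A 0 2) (A 0 3) (A 0 4) (A 1 2) (A 1 3) (A 1 4) (A 2 3) (A 2 4) (A 3 4) := by
    funext i j
    fin_cases i <;> fin_cases j <;>
      first
      | exact hi _
      | rfl
      | exact hs _ _
  rw [hA]
  exact h

theorem permC3_inj : ∀ q ∈ permC3, Function.Injective q := by
  decide +kernel

theorem permC5_inj : ∀ q ∈ permC5, Function.Injective q := by
  decide +kernel

theorem permT2_inj : ∀ q ∈ permT2, Function.Injective q := by
  decide +kernel

theorem permT1_inj : ∀ q ∈ permT1, Function.Injective q := by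
  decide +kernel

theorem permPaw_inj : ∀ q ∈ permPaw, Function.Injective q := by
  decide +kernel

theorem repC3 : AdjRep (SimpleGraph.cycleGraph 3) (Equiv.refl _) adjC3 := by
  unfold AdjRep
  simp only [SimpleGraph.cycleGraph_adj]
  decide

theorem repC5 : AdjRep (SimpleGraph.cycleGraph 5) (Equiv.refl _) adjC5 := by
  unfold AdjRep
  simp only [SimpleGraph.cycleGraph_adj]
  decide

theorem repT2 : AdjRep ((⊤ : SimpleGraph (Fin 3)) ⊕g (⊤ : SimpleGraph (Fin 2)))
    finSumFinEquiv adjT2 := by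
  rintro (u | u) (v | v) <;> fin_cases u <;> fin_cases v <;>
    simp [SimpleGraph.sum] <;> decide

theorem repT1 : AdjRep ((⊤ : SimpleGraph (Fin 3)) ⊕g (⊥ : SimpleGraph (Fin 1)))
    finSumFinEquiv adjT1 := by
  rintro (u | u) (v | v) <;> fin_cases u <;> fin_cases v <;>
    simp [SimpleGraph.sum] <;> decide

theorem repPaw : AdjRep pawGraph (Equiv.refl _) adjPaw := by
  unfold AdjRep pawGraph
  simp only [SimpleGraph.fromRel_adj]
  decide

theorem exists_rep {n : ℕ} (G : SimpleGraph V) (hn : Fintype.card V = n) :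
    ∃ (e : V ≃ Fin n) (A : Fin n → Fin n → Bool), AdjRep G e A ∧ (∀ i j, A i j = A j i) ∧
      ∀ i, A i i = false := by
  classical
  refine ⟨Fintype.equivFinOfCardEq hn, fun i j => decide (G.Adj
    ((Fintype.equivFinOfCardEq hn).symm i) ((Fintype.equivFinOfCardEq hn).symm j)), ?_, ?_, ?_⟩
  · intro u v
    simp
  · intro i j
    simp [G.adj_comm]
  · intro i
    simp

theorem villainy_ge_three_of_order_le_five (G : SimpleGraph V)
    (hn : Fintype.card V ≤ 5) (hchi : chromNum G = 3) :
    3 ≤ villainy G ∨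
    Nonempty (G ≃g SimpleGraph.cycleGraph 3) ∨
    Nonempty (G ≃g SimpleGraph.cycleGraph 5) ∨
    Nonempty (G ≃g (⊤ : SimpleGraph (Fin 3)) ⊕g (⊤ : SimpleGraph (Fin 2))) ∨
    Nonempty (G ≃g (⊤ : SimpleGraph (Fin 3)) ⊕g (⊥ : SimpleGraph (Fin 1))) ∨
    Nonempty (G ≃g pawGraph) := by
  have h3 : 3 ≤ Fintype.card V := by
    by_contra hlt
    exact not_two hchi ((SimpleGraph.colorable_of_fintype G).mono (by omega))
  obtain h | h | h : Fintype.card V = 3 ∨ Fintype.card V = 4 ∨ Fintype.card V = 5 := by omega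
  · obtain ⟨e, A, hA, hs, hi⟩ := exists_rep G h
    have hk := chk_true3 A hs hi
    simp only [chk3, Bool.or_eq_true] at hk
    rcases hk with hk | hk | hk | hk
    · exact absurd hk (twoB_sound hchi hA pairsOk3 two_ok3)
    · exact absurd hk (k4B_sound hchi hA)
    · exact Or.inl (certB_sound hchi hA pairsOk3 groups_ok3 hk)
    · exact Or.inr (Or.inl (isoB_sound hA repC3 pairsOk3 permC3_inj hk))
  · obtain ⟨e, A, hA, hs, hi⟩ := exists_rep G h
    have hk := chk_true4 A hs hi
    simp only [chk4, Bool.or_eq_true] at hk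
    rcases hk with hk | hk | hk | hk | hk
    · exact absurd hk (twoB_sound hchi hA pairsOk4 two_ok4)
    · exact absurd hk (k4B_sound hchi hA)
    · exact Or.inl (certB_sound hchi hA pairsOk4 groups_ok4 hk)
    · exact Or.inr (Or.inr (Or.inr (Or.inr (Or.inl
        (isoB_sound hA repT1 pairsOk4 permT1_inj hk)))))
    · exact Or.inr (Or.inr (Or.inr (Or.inr (Or.inr
        (isoB_sound hA repPaw pairsOk4 permPaw_inj hk)))))
  · obtain ⟨e, A, hA, hs, hi⟩ := exists_rep G h
    have hk := chk_true5 A hs hi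
    simp only [chk5, Bool.or_eq_true] at hk
    rcases hk with hk | hk | hk | hk | hk
    · exact absurd hk (twoB_sound hchi hA pairsOk5 two_ok5)
    · exact absurd hk (k4B_sound hchi hA)
    · exact Or.inl (certB_sound hchi hA pairsOk5 groups_ok5 hk)
    · exact Or.inr (Or.inr (Or.inl (isoB_sound hA repC5 pairsOk5 permC5_inj hk)))
    · exact Or.inr (Or.inr (Or.inr (Or.inl (isoB_sound hA repT2 pairsOk5 permT2_inj hk))))
end

section
/- If G is a graph with χ(G) ≥ 4, then B(G) ≥ 3 unless G is a complete graph or G has a vertex v of degree at most 1 such that G − v is a complete graph. -/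
open Finset

variable {V : Type*}

variable [Fintype V] [DecidableEq V]

theorem exists_perm_tuple {n : ℕ} (x y : Fin n → V) (hx : Function.Injective x)
    (hy : Function.Injective y) : ∃ σ : Equiv.Perm V, ∀ i, σ (x i) = y i := by
  have := (Equiv.Perm.isMultiplyPretransitive V n).exists_smul_eq ⟨x, hx⟩ ⟨y, hy⟩
  obtain ⟨g, hg⟩ := this
  refine ⟨g, fun i => ?_⟩
  have := DFunLike.congr_fun hg i
  simpa using this

/-- If two colorings with equal counts differ in at most two places, they differ by a swap. -/
theorem swap_of_le_two {c c' : V → ℕ} (h : SameColorCounts c c') (h2 : recolorCount c c' ≤ 2)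
    {x : V} (hx : c' x ≠ c x) :
    ∃ y, y ≠ x ∧ c' y = c x ∧ c' x = c y ∧ c y ≠ c x ∧ ∀ z, z ≠ x → z ≠ y → c' z = c z := by
  have key : ∀ x, c' x ≠ c x → ∃ y, c' y = c x ∧ c y ≠ c x := by
    intro x hx
    by_contra! hcon
    have hss : (univ.filter fun v => c' v = c x) ⊂ (univ.filter fun v => c v = c x) := by
      rw [Finset.ssubset_iff_of_subset]
      · exact ⟨x, by simp, by simpa using hx⟩
      · intro v hv
        simp only [mem_filter, mem_univ, true_and] at hv ⊢
        exact hcon v hv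
    have := Finset.card_lt_card hss
    have := h (c x)
    omega
  have three : ∀ u v w : V, u ≠ v → u ≠ w → v ≠ w → c u ≠ c' u → c v ≠ c' v → c w ≠ c' w →
      False := by
    intro u v w h1 h3 h4 h5 h6 h7
    have hs : ({u, v, w} : Finset V) ⊆ (univ.filter fun v => c v ≠ c' v) := by
      intro z hz
      simp only [mem_insert, mem_singleton] at hz
      rcases hz with rfl | rfl | rfl <;> simpa
    have := Finset.card_le_card hs
    rw [Finset.card_eq_three.2 ⟨u, v, w, h1, h3, h4, rfl⟩] at this
    unfold recolorCount at h2
    omega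
  obtain ⟨y, hy1, hy2⟩ := key x hx
  have hyx : y ≠ x := by rintro rfl; exact hy2 rfl
  have hy : c' y ≠ c y := by rw [hy1]; exact hy2.symm
  obtain ⟨w, hw1, hw2⟩ := key y hy
  have hwx : w = x := by
    by_contra hne
    have hwy : w ≠ y := by rintro rfl; exact hw2 rfl
    exact three w x y hne hwy hyx.symm (by rw [hw1]; exact hw2) hx.symm hy.symm
  subst hwx
  refine ⟨y, hyx, hy1, hw1, hy2, fun z h1 h3 => ?_⟩
  by_contra hz
  exact three z w y h1 h3 hyx.symm (Ne.symm hz) hx.symm hy.symm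

theorem villainy_ge_three_of {G : SimpleGraph V} {f : V → ℕ} (hf : IsOptimalColoring G f)
    (σ : Equiv.Perm V)
    (h : ∀ c', IsProperColoring G c' → SameColorCounts (f ∘ σ) c' →
      recolorCount (f ∘ σ) c' ≤ 2 → False) : 3 ≤ villainy G := by
  have hne : ∀ f σ, IsOptimalColoring G f → ∃ n, n ∈ {n | ∃ c', IsProperColoring G c' ∧
      SameColorCounts (f ∘ (σ : Equiv.Perm V)) c' ∧ recolorCount (f ∘ σ) c' = n} := by
    intro f σ hf
    refine ⟨_, f, hf.1, fun k => ?_, rfl⟩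
    exact Finset.card_equiv σ (by simp)
  have hle : ∀ f σ, IsOptimalColoring G f →
      colVillainy G (f ∘ (σ : Equiv.Perm V)) ≤ Fintype.card V := by
    intro f σ hf
    obtain ⟨c', -, -, h3⟩ := Nat.sInf_mem (hne f σ hf)
    unfold colVillainy
    rw [← h3]
    exact Finset.card_le_univ _
  have h3 : 3 ≤ colVillainy G (f ∘ σ) := by
    obtain ⟨c', h1, h2, h3⟩ := Nat.sInf_mem (hne f σ hf)
    unfold colVillainy
    rw [← h3]
    by_contra hlt
    exact h c' h1 h2 (by omega)
  refine h3.trans (le_csSup ⟨Fintype.card V, ?_⟩ ⟨f, f ∘ σ, hf, ⟨σ, rfl⟩, rfl⟩)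
  rintro n ⟨f, c, hf, ⟨σ, rfl⟩, rfl⟩
  exact hle f σ hf

theorem win_triangle {G : SimpleGraph V} {f : V → ℕ} (hf : IsOptimalColoring G f)
    {a b d x y z : V} (h1 : a ≠ b) (h2 : a ≠ d) (h3 : b ≠ d) (hab : f a = f b) (had : f a = f d)
    (hxy : G.Adj x y) (hxz : G.Adj x z) (hyz : G.Adj y z) : 3 ≤ villainy G := by
  have e1 := hxy.ne
  have e2 := hxz.ne
  have e3 := hyz.ne
  obtain ⟨σ, hσ⟩ := exists_perm_tuple ![x, y, z] ![a, b, d]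
    (by intro i j; fin_cases i <;> fin_cases j <;> simp <;> grind)
    (by intro i j; fin_cases i <;> fin_cases j <;> simp <;> grind)
  have s1 : σ x = a := hσ 0
  have s2 : σ y = b := hσ 1
  have s3 : σ z = d := hσ 2
  refine villainy_ge_three_of hf σ fun c' hp hs hr => ?_
  have cx : (f ∘ σ) x = f a := by simp [s1]
  have cy : (f ∘ σ) y = f a := by simp [s2, hab]
  have cz : (f ∘ σ) z = f a := by simp [s3, had]
  have key := fun v => @swap_of_le_two V _ _ _ _ hs hr v
  generalize f ∘ σ = c at *
  have p1 := hp hxy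
  have p2 := hp hxz
  have p3 := hp hyz
  have k1 := key x
  have k2 := key y
  have k3 := key z
  grind

theorem win_two {G : SimpleGraph V} {f : V → ℕ} (hf : IsOptimalColoring G f)
    {i i' j j' a b x y : V} (hi : i ≠ i') (hj : j ≠ j') (hii : f i = f i') (hjj : f j = f j')
    (hij : f i ≠ f j) (hab : G.Adj a b) (hxy : G.Adj x y) (hax : a ≠ x) (hay : a ≠ y)
    (hbx : b ≠ x) (hby : b ≠ y) (h1 : G.Adj a x ∨ G.Adj b y) (h2 : G.Adj a y ∨ G.Adj b x) :
    3 ≤ villainy G := by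
  have e1 := hab.ne
  have e2 := hxy.ne
  obtain ⟨σ, hσ⟩ := exists_perm_tuple ![a, b, x, y] ![i, i', j, j']
    (by intro i j; fin_cases i <;> fin_cases j <;> simp <;> grind)
    (by intro i j; fin_cases i <;> fin_cases j <;> simp <;> grind)
  have s1 : σ a = i := hσ 0
  have s2 : σ b = i' := hσ 1
  have s3 : σ x = j := hσ 2
  have s4 : σ y = j' := hσ 3
  refine villainy_ge_three_of hf σ fun c' hp hs hr => ?_
  have ca : (f ∘ σ) a = f i := by simp [s1]
  have cb : (f ∘ σ) b = f i := by simp [s2, hii]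
  have cx : (f ∘ σ) x = f j := by simp [s3]
  have cy : (f ∘ σ) y = f j := by simp [s4, hjj]
  have key := fun v => @swap_of_le_two V _ _ _ _ hs hr v
  generalize f ∘ σ = c at *
  have p1 := hp hab
  have p2 := hp hxy
  have q1 : c' a ≠ c' x ∨ c' b ≠ c' y := h1.imp (fun h => hp h) (fun h => hp h)
  have q2 : c' a ≠ c' y ∨ c' b ≠ c' x := h2.imp (fun h => hp h) (fun h => hp h)
  have k1 := key a
  have k2 := key b
  clear key hs hr hp hσ
  by_cases ha : c' a = c a
  · obtain ⟨w, hw⟩ := k2 (by grind)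
    obtain ⟨w1, w2, w3, w4, w5⟩ := hw
    have g1 := w5 x
    have g2 := w5 y
    clear k1 k2
    by_cases d1 : x = w <;> by_cases d2 : y = w <;> grind
  · obtain ⟨w, hw⟩ := k1 ha
    obtain ⟨w1, w2, w3, w4, w5⟩ := hw
    have g1 := w5 x
    have g2 := w5 y
    have g3 := w5 b
    clear k1 k2
    by_cases d1 : x = w <;> by_cases d2 : y = w <;> grind

theorem win_three {G : SimpleGraph V} {f : V → ℕ} (hf : IsOptimalColoring G f)
    {i i' j j' l l' a b x y u v : V} (hi : i ≠ i') (hj : j ≠ j') (hl : l ≠ l')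
    (hii : f i = f i') (hjj : f j = f j') (hll : f l = f l')
    (hij : f i ≠ f j) (hil : f i ≠ f l) (hjl : f j ≠ f l)
    (hab : G.Adj a b) (hxy : G.Adj x y) (huv : G.Adj u v) (hax : a ≠ x) (hay : a ≠ y)
    (hbx : b ≠ x) (hby : b ≠ y) (hau : a ≠ u) (hav : a ≠ v) (hbu : b ≠ u) (hbv : b ≠ v)
    (hxu : x ≠ u) (hxv : x ≠ v) (hyu : y ≠ u) (hyv : y ≠ v) :
    3 ≤ villainy G := by
  have e1 := hab.ne
  have e2 := hxy.ne
  have e3 := huv.ne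
  obtain ⟨σ, hσ⟩ := exists_perm_tuple ![a, b, x, y, u, v] ![i, i', j, j', l, l']
    (by intro i j; fin_cases i <;> fin_cases j <;> simp <;> grind)
    (by intro i j; fin_cases i <;> fin_cases j <;> simp <;> grind)
  have s1 : σ a = i := hσ 0
  have s2 : σ b = i' := hσ 1
  have s3 : σ x = j := hσ 2
  have s4 : σ y = j' := hσ 3
  have s5 : σ u = l := hσ 4
  have s6 : σ v = l' := hσ 5
  refine villainy_ge_three_of hf σ fun c' hp hs hr => ?_
  have ca : (f ∘ σ) a = f i := by simp [s1]
  have cb : (f ∘ σ) b = f i := by simp [s2, hii]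
  have cx : (f ∘ σ) x = f j := by simp [s3]
  have cy : (f ∘ σ) y = f j := by simp [s4, hjj]
  have cu : (f ∘ σ) u = f l := by simp [s5]
  have cv : (f ∘ σ) v = f l := by simp [s6, hll]
  have key := fun v => @swap_of_le_two V _ _ _ _ hs hr v
  generalize f ∘ σ = c at *
  have p1 := hp hab
  have p2 := hp hxy
  have p3 := hp huv
  have k1 := key a
  have k2 := key b
  clear key hs hr hp hσ
  by_cases ha : c' a = c a
  · obtain ⟨w, hw⟩ := k2 (by grind)
    obtain ⟨w1, w2, w3, w4, w5⟩ := hw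
    have g1 := w5 x
    have g2 := w5 y
    have g4 := w5 u
    have g5 := w5 v
    clear k1 k2
    by_cases d1 : x = w <;> by_cases d2 : y = w <;>
      by_cases d3 : u = w <;> by_cases d4 : v = w <;> grind
  · obtain ⟨w, hw⟩ := k1 ha
    obtain ⟨w1, w2, w3, w4, w5⟩ := hw
    have g1 := w5 x
    have g2 := w5 y
    have g3 := w5 b
    have g4 := w5 u
    have g5 := w5 v
    clear k1 k2
    by_cases d1 : x = w <;> by_cases d2 : y = w <;>
      by_cases d3 : u = w <;> by_cases d4 : v = w <;> grind

theorem win_dom {G : SimpleGraph V} {f : V → ℕ} (hf : IsOptimalColoring G f)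
    {i i' s t : V} (hi : i ≠ i') (hii : f i = f i') (hst : s ≠ t)
    (hs : ∀ z, z ≠ s → G.Adj s z) (ht : ∀ z, z ≠ t → G.Adj t z) : 3 ≤ villainy G := by
  obtain ⟨σ, hσ⟩ := exists_perm_tuple ![s, t] ![i, i']
    (by intro i j; fin_cases i <;> fin_cases j <;> simp <;> grind)
    (by intro i j; fin_cases i <;> fin_cases j <;> simp <;> grind)
  have s1 : σ s = i := hσ 0
  have s2 : σ t = i' := hσ 1
  refine villainy_ge_three_of hf σ fun c' hp hs' hr => ?_
  have ca : (f ∘ σ) s = f i := by simp [s1]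
  have cb : (f ∘ σ) t = f i := by simp [s2, hii]
  have key := fun v => @swap_of_le_two V _ _ _ _ hs' hr v
  generalize f ∘ σ = c at *
  have q1 : ∀ z, z ≠ s → c' s ≠ c' z := fun z hz => hp (hs z hz)
  have q2 : ∀ z, z ≠ t → c' t ≠ c' z := fun z hz => hp (ht z hz)
  have p1 := q1 t hst.symm
  have k1 := key s
  have k2 := key t
  clear key hs' hr hp hσ
  by_cases ha : c' s = c s
  · obtain ⟨w, hw⟩ := k2 (by grind)
    grind
  · obtain ⟨w, hw⟩ := k1 ha
    grind

theorem chromNum_le {G : SimpleGraph V} {g : V → ℕ} (hg : IsProperColoring G g) :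
    chromNum G ≤ (univ.image g).card := by
  have hc : G.Colorable (univ.image g).card := by
    let C : G.Coloring (univ.image g) :=
      SimpleGraph.Coloring.mk (fun v => ⟨g v, by simp⟩) (by
        intro u v h e
        exact hg h (by simpa using e))
    have := C.colorable
    simpa using this
  have := hc.chromaticNumber_le
  exact ENat.toNat_le_of_le_natCast this

theorem exists_optimal (G : SimpleGraph V) : ∃ f, IsOptimalColoring G f := by
  have hc : G.Colorable (chromNum G) := SimpleGraph.colorable_chromaticNumber_of_fintype G
  obtain ⟨C⟩ := hc
  have hp : IsProperColoring G (fun v => (C v : ℕ)) := by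
    intro u v h e
    exact C.valid h (Fin.ext e)
  refine ⟨_, hp, le_antisymm ?_ (chromNum_le hp)⟩
  have : univ.image (fun v => (C v : ℕ)) ⊆ Finset.range (chromNum G) := by
    intro k hk
    simp only [mem_image, mem_univ, true_and] at hk
    obtain ⟨v, rfl⟩ := hk
    simp
  simpa using Finset.card_le_card this

/-- Every class of an optimal coloring has a vertex seeing all other colors. -/
theorem exists_bvertex {G : SimpleGraph V} {f : V → ℕ} (hf : IsOptimalColoring G f) (w : V) :
    ∃ v, f v = f w ∧ ∀ u, f u ≠ f w → ∃ u', G.Adj v u' ∧ f u' = f u := by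
  by_contra! hcon
  choose! j hj1 hj2 using hcon
  let g : V → ℕ := fun v => if f v = f w then f (j v) else f v
  have hg : IsProperColoring G g := by
    intro u v h e
    have h1 := hf.1 h
    have h2 := hj2 u
    have h3 := hj2 v
    have h4 := h.symm
    simp only [g] at e
    split_ifs at e <;> grind
  have h1 := chromNum_le hg
  have h2 : univ.image g ⊆ (univ.image f).erase (f w) := by
    intro k hk
    simp only [mem_image, mem_univ, true_and] at hk
    obtain ⟨v, rfl⟩ := hk
    simp only [mem_erase, mem_image, mem_univ, true_and, g]
    split_ifs with h
    · exact ⟨hj1 v h, _, rfl⟩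
    · exact ⟨h, _, rfl⟩
  have h3 := Finset.card_le_card h2
  rw [Finset.card_erase_of_mem (by simp), hf.2] at h3
  have : 0 < chromNum G := by
    rw [← hf.2]; exact Finset.card_pos.2 ⟨f w, by simp⟩
  omega

theorem no_three {G : SimpleGraph V} (hchi : 4 ≤ chromNum G) {g : V → ℕ}
    (hg : IsProperColoring G g) (h : ∀ v, g v < 3) : False := by
  have h1 := chromNum_le hg
  have h2 : univ.image g ⊆ Finset.range 3 := by
    intro k hk
    simp only [mem_image, mem_univ, true_and] at hk
    obtain ⟨v, rfl⟩ := hk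
    simpa using h v
  have h3 := Finset.card_le_card h2
  simp only [card_range] at h3
  omega

theorem win_many {G : SimpleGraph V} (hchi : 4 ≤ chromNum G) {f : V → ℕ}
    (hf : IsOptimalColoring G f)
    {i i' j j' l l' : V} (hi : i ≠ i') (hj : j ≠ j') (hl : l ≠ l')
    (hii : f i = f i') (hjj : f j = f j') (hll : f l = f l')
    (hij : f i ≠ f j) (hil : f i ≠ f l) (hjl : f j ≠ f l) : 3 ≤ villainy G := by
  obtain ⟨a, b, hab⟩ : ∃ a b, G.Adj a b := by
    by_contra! hcon
    exact no_three hchi (g := fun _ => 0) (fun u v h => absurd h (hcon u v)) (by simp)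
  obtain ⟨x, y, hxy, hax, hay, hbx, hby⟩ :
      ∃ x y, G.Adj x y ∧ a ≠ x ∧ a ≠ y ∧ b ≠ x ∧ b ≠ y := by
    by_contra! hcon
    refine no_three hchi (g := fun v => if v = a then 1 else if v = b then 2 else 0) ?_ ?_
    · intro u v h
      have := hcon u v h
      have := h.ne
      grind
    · intro v; grind
  by_cases h1 : G.Adj a x ∨ G.Adj b y
  · by_cases h2 : G.Adj a y ∨ G.Adj b x
    · exact win_two hf hi hj hii hjj hij hab hxy hax hay hbx hby h1 h2
    · obtain ⟨u, v, huv, n1, n2, n3, n4, n5, n6, n7, n8⟩ : ∃ u v, G.Adj u v ∧ a ≠ u ∧ a ≠ v ∧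
          b ≠ u ∧ b ≠ v ∧ x ≠ u ∧ x ≠ v ∧ y ≠ u ∧ y ≠ v := by
        by_contra! hcon
        refine no_three hchi
          (g := fun v => if v = a ∨ v = y then 1 else if v = b ∨ v = x then 2 else 0) ?_ ?_
        · intro u v h
          have := hcon u v h
          have := h.ne
          have := h.symm
          grind
        · intro v; grind
      exact win_three hf hi hj hl hii hjj hll hij hil hjl hab hxy huv hax hay hbx hby
        n1 n2 n3 n4 n5 n6 n7 n8
  · obtain ⟨u, v, huv, n1, n2, n3, n4, n5, n6, n7, n8⟩ : ∃ u v, G.Adj u v ∧ a ≠ u ∧ a ≠ v ∧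
        b ≠ u ∧ b ≠ v ∧ x ≠ u ∧ x ≠ v ∧ y ≠ u ∧ y ≠ v := by
      by_contra! hcon
      refine no_three hchi
        (g := fun v => if v = a ∨ v = x then 1 else if v = b ∨ v = y then 2 else 0) ?_ ?_
      · intro u v h
        have := hcon u v h
        have := h.ne
        have := h.symm
        grind
      · intro v; grind
    exact win_three hf hi hj hl hii hjj hll hij hil hjl hab hxy huv hax hay hbx hby
      n1 n2 n3 n4 n5 n6 n7 n8

theorem villainy_ge_three_of_chrom_ge_four (G : SimpleGraph V)
    [DecidableRel G.Adj] (hchi : 4 ≤ chromNum G) :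
    3 ≤ villainy G ∨ G = ⊤ ∨
    ∃ v : V, G.degree v ≤ 1 ∧ ∀ a b : V, a ≠ v → b ≠ v → a ≠ b → G.Adj a b := by
  obtain ⟨f, hf⟩ := exists_optimal G
  -- adjacency of vertices with unique colors
  have huniq : ∀ s t, s ≠ t → (∀ z, f z = f s → z = s) → (∀ z, f z = f t → z = t) →
      G.Adj s t := by
    intro s t hst hs ht
    obtain ⟨v, hv, hv2⟩ := exists_bvertex hf s
    obtain ⟨u, hu1, hu2⟩ := hv2 t (fun h => hst (hs t h).symm)
    rw [← hs v hv, ← ht u hu2]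
    exact hu1
  -- adjacency of a b-vertex with a vertex of unique color
  by_cases h0 : ∀ a b, f a = f b → a = b
  · right; left
    ext a b
    rw [SimpleGraph.top_adj]
    exact ⟨fun h => h.ne, fun h => huniq a b h (fun z hz => h0 _ _ hz) (fun z hz => h0 _ _ hz)⟩
  push Not at h0
  obtain ⟨i, i', hii, hi⟩ := h0
  by_cases h1 : ∃ j j', f j = f j' ∧ j ≠ j' ∧ f j ≠ f i
  · left
    obtain ⟨j, j', hjj, hj, hji⟩ := h1
    by_cases h2 : ∃ l l', f l = f l' ∧ l ≠ l' ∧ f l ≠ f i ∧ f l ≠ f j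
    · obtain ⟨l, l', hll, hl, hli, hlj⟩ := h2
      exact win_many hchi hf hi hj hl hii hjj hll hji.symm hli.symm hlj.symm
    · push Not at h2
      have hcard : 1 < (((univ.image f).erase (f i)).erase (f j)).card := by
        have a1 := Finset.pred_card_le_card_erase (s := (univ.image f).erase (f i)) (a := f j)
        have a2 := Finset.pred_card_le_card_erase (s := univ.image f) (a := f i)
        have := hf.2
        omega
      obtain ⟨s', hs', t', ht', hst'⟩ := Finset.one_lt_card.1 hcard
      simp only [mem_erase, mem_image, mem_univ, true_and] at hs' ht'
      obtain ⟨hs1, hs2, s, rfl⟩ := hs'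
      obtain ⟨ht1, ht2, t, rfl⟩ := ht'
      have us : ∀ z, f z = f s → z = s := by
        intro z hz; by_contra hne; exact hs1 ((hz ▸ h2 z s hz hne (hz ▸ hs2)))
      have ut : ∀ z, f z = f t → z = t := by
        intro z hz; by_contra hne; exact ht1 ((hz ▸ h2 z t hz hne (hz ▸ ht2)))
      have hst := huniq s t (fun h => hst' (by rw [h])) us ut
      obtain ⟨p, hp, hp2⟩ := exists_bvertex hf i
      obtain ⟨q, hq, hqj⟩ := hp2 j hji
      obtain ⟨s'', hs3, hs4⟩ := hp2 s hs2
      obtain ⟨t'', ht3, ht4⟩ := hp2 t ht2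
      rw [us _ hs4] at hs3
      rw [ut _ ht4] at ht3
      refine win_two hf hi hj hii hjj hji.symm hst hq hs3.ne.symm ?_ ht3.ne.symm ?_
        (Or.inl hs3.symm) (Or.inr ht3.symm)
      · rintro rfl; exact hs1 hqj
      · rintro rfl; exact ht1 hqj
  · push Not at h1
    obtain ⟨p, hp, hp2⟩ := exists_bvertex hf i
    have uq : ∀ s, f s ≠ f i → ∀ z, f z = f s → z = s := by
      intro s hs z hz; by_contra hne; exact hs (h1 s z hz.symm (Ne.symm hne))
    have padj : ∀ s, f s ≠ f i → G.Adj p s := by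
      intro s hs
      obtain ⟨u, hu, hu2⟩ := hp2 s hs
      rwa [uq s hs u hu2] at hu
    obtain ⟨p', hp', hpp⟩ : ∃ p', f p' = f i ∧ p' ≠ p := by
      by_cases h : i = p
      · exact ⟨i', hii.symm, fun e => hi (h.trans e.symm)⟩
      · exact ⟨i, rfl, h⟩
    by_cases h3 : ∃ r, f r = f i ∧ r ≠ p ∧ r ≠ p'
    · left
      obtain ⟨r, hr, hrp, hrp'⟩ := h3
      have hcard : 1 < ((univ.image f).erase (f i)).card := by
        have a2 := Finset.pred_card_le_card_erase (s := univ.image f) (a := f i)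
        have := hf.2
        omega
      obtain ⟨s', hs', t', ht', hst'⟩ := Finset.one_lt_card.1 hcard
      simp only [mem_erase, mem_image, mem_univ, true_and] at hs' ht'
      obtain ⟨hs2, s, rfl⟩ := hs'
      obtain ⟨ht2, t, rfl⟩ := ht'
      have hst := huniq s t (fun h => hst' (by rw [h])) (uq s hs2) (uq t ht2)
      exact win_triangle hf hpp.symm hrp.symm hrp'.symm (hp.trans hp'.symm) (hp.trans hr.symm)
        (padj s hs2) (padj t ht2) hst
    · push Not at h3
      have hclass : ∀ z, z ≠ p → z ≠ p' → f z ≠ f i := fun z h h' e => h' (h3 z e h)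
      have hK : ∀ a b : V, a ≠ p' → b ≠ p' → a ≠ b → G.Adj a b := by
        intro a b ha hb hab
        by_cases hap : a = p
        · subst hap; exact padj b (hclass b hab.symm hb)
        · by_cases hbp : b = p
          · subst hbp; exact (padj a (hclass a hap ha)).symm
          · exact huniq a b hab (uq a (hclass a hap ha)) (uq b (hclass b hbp hb))
      by_cases hd : G.degree p' ≤ 1
      · exact Or.inr (Or.inr ⟨p', hd, hK⟩)
      · left
        push Not at hd
        obtain ⟨s, hs, t, ht, hst⟩ := Finset.one_lt_card.1 hd
        rw [SimpleGraph.mem_neighborFinset] at hs ht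
        refine win_dom hf hi hii hst ?_ ?_
        · intro z hz
          by_cases h : z = p'
          · subst h; exact hs.symm
          · exact hK s z hs.ne.symm h hz.symm
        · intro z hz
          by_cases h : z = p'
          · subst h; exact ht.symm
          · exact hK t z ht.ne.symm h hz.symm
end

section
/- If B(G) = 2 and χ(G) = 3, then G has at most 6 vertices, and if G has exactly 6 vertices then G is the disjoint union of two triangles. -/
open Finset

variable {V : Type*}

variable [Fintype V] [DecidableEq V]

/-- Every permutation of the coloring `f` is at most two recolorings away from a proper one. -/
def NearProper (G : SimpleGraph V) (f : V → ℕ) : Prop :=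
  ∀ σ : Equiv.Perm V, ∃ c' : V → ℕ, IsProperColoring G c' ∧ SameColorCounts (f ∘ σ) c' ∧
    recolorCount (f ∘ σ) c' ≤ 2

lemma sameColorCounts_perm (f : V → ℕ) (σ : Equiv.Perm V) : SameColorCounts (f ∘ σ) f := by
  intro k
  apply Finset.card_bij (fun v _ => σ v)
  · intro a ha; simpa using ha
  · intro a _ b _ h; exact σ.injective h
  · intro b hb; exact ⟨σ.symm b, by simpa using hb, by simp⟩

lemma recolorCount_le (c c' : V → ℕ) : recolorCount c c' ≤ Fintype.card V := by
  unfold recolorCount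
  exact Finset.card_le_univ _

lemma nearProper_of_villainy (G : SimpleGraph V) (hB : villainy G = 2) (f : V → ℕ)
    (hf : IsOptimalColoring G f) : NearProper G f := by
  intro σ
  have hne : {n | ∃ c', IsProperColoring G c' ∧ SameColorCounts (f ∘ σ) c' ∧
      recolorCount (f ∘ σ) c' = n}.Nonempty :=
    ⟨_, f, hf.1, sameColorCounts_perm f σ, rfl⟩
  have hle : colVillainy G (f ∘ σ) ≤ 2 := by
    rw [← hB]
    apply le_csSup
    · refine ⟨Fintype.card V, ?_⟩
      rintro n ⟨f', c, hf', ⟨τ, rfl⟩, rfl⟩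
      have hmem : recolorCount (f' ∘ τ) f' ∈ {n | ∃ c', IsProperColoring G c' ∧
          SameColorCounts (f' ∘ τ) c' ∧ recolorCount (f' ∘ τ) c' = n} :=
        ⟨f', hf'.1, sameColorCounts_perm f' τ, rfl⟩
      exact (Nat.sInf_le hmem).trans (recolorCount_le _ _)
    · exact ⟨f, _, hf, ⟨σ, rfl⟩, rfl⟩
  obtain ⟨c', h1, h2, h3⟩ := Nat.sInf_mem hne
  exact ⟨c', h1, h2, h3.trans_le hle⟩

lemma swap_structure (c c' : V → ℕ) (hs : SameColorCounts c c') (hr : recolorCount c c' ≤ 2)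
    {u v : V} (huv : u ≠ v) (hu : c u ≠ c' u) (hv : c v ≠ c' v) :
    c' v = c u ∧ ∀ w, w ≠ u → w ≠ v → c w = c' w := by
  classical
  have hS : (univ.filter fun w => c w ≠ c' w) = {u, v} := by
    symm
    apply Finset.eq_of_subset_of_card_le
    · intro w hw
      simp only [mem_insert, mem_singleton] at hw
      rcases hw with rfl | rfl <;> simpa
    · rw [Finset.card_pair huv]; exact hr
  have hoth : ∀ w, w ≠ u → w ≠ v → c w = c' w := by
    intro w h1 h2
    by_contra h
    have : w ∈ (univ.filter fun w => c w ≠ c' w) := by simpa using h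
    rw [hS] at this
    simp [h1, h2] at this
  refine ⟨?_, hoth⟩
  by_contra hne
  have hlt : (univ.filter fun w => c' w = c u).card < (univ.filter fun w => c w = c u).card := by
    apply Finset.card_lt_card
    rw [Finset.ssubset_iff_of_subset]
    · exact ⟨u, by simp, by simpa using fun h => hu h.symm⟩
    · intro w hw
      simp only [mem_filter, mem_univ, true_and] at hw ⊢
      by_cases h1 : w = u
      · rw [h1]
      by_cases h2 : w = v
      · rw [h2] at hw; exact absurd hw hne
      rw [hoth w h1 h2]; exact hw
  exact absurd (hs (c u)) hlt.ne'

lemma nearProper_extend {G : SimpleGraph V} {f : V → ℕ} (h : NearProper G f) {n : ℕ}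
    (p q : Fin n → V) (hp : Function.Injective p) (hq : Function.Injective q) :
    ∃ c c' : V → ℕ, (∀ i, c (p i) = f (q i)) ∧ (∀ ⦃u v⦄, G.Adj u v → c' u ≠ c' v) ∧
      (∀ u v, u ≠ v → c u ≠ c' u → c v ≠ c' v →
        c' v = c u ∧ ∀ w, w ≠ u → w ≠ v → c w = c' w) := by
  obtain ⟨σ, hσ⟩ := Equiv.Perm.exists_extending_pair p q hp hq
  obtain ⟨c', h1, h2, h3⟩ := h σ
  refine ⟨f ∘ σ, c', fun i => by simp [hσ], h1, fun u v huv hu hv => ?_⟩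
  exact swap_structure _ _ h2 h3 huv hu hv

lemma no_three_edges {G : SimpleGraph V} {f : V → ℕ} (h : NearProper G f)
    (p q : Fin 6 → V) (hp : Function.Injective p) (hq : Function.Injective q)
    (e1 : G.Adj (p 0) (p 1)) (e2 : G.Adj (p 2) (p 3)) (e3 : G.Adj (p 4) (p 5))
    (f1 : f (q 0) = f (q 1)) (f2 : f (q 2) = f (q 3)) (f3 : f (q 4) = f (q 5)) : False := by
  obtain ⟨c, c', h1, h2, h3⟩ := nearProper_extend h p q hp hq
  have key : ∀ i j : Fin 6, G.Adj (p i) (p j) → f (q i) = f (q j) →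
      ∃ k, (k = i ∨ k = j) ∧ c (p k) ≠ c' (p k) := by
    intro i j e g
    by_contra hcon
    push Not at hcon
    have a := hcon i (Or.inl rfl)
    have b := hcon j (Or.inr rfl)
    apply h2 e
    rw [← a, ← b, h1, h1, g]
  obtain ⟨i, hi, hi'⟩ := key 0 1 e1 f1
  obtain ⟨j, hj, hj'⟩ := key 2 3 e2 f2
  obtain ⟨k, hk, hk'⟩ := key 4 5 e3 f3
  have hij : i ≠ j := by rcases hi with rfl | rfl <;> rcases hj with rfl | rfl <;> decide
  have hki : k ≠ i := by rcases hi with rfl | rfl <;> rcases hk with rfl | rfl <;> decide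
  have hkj : k ≠ j := by rcases hk with rfl | rfl <;> rcases hj with rfl | rfl <;> decide
  exact hk' ((h3 _ _ (hp.ne hij) hi' hj').2 _ (hp.ne hki) (hp.ne hkj))

lemma no_two_edges {G : SimpleGraph V} {f : V → ℕ} (h : NearProper G f)
    (p q : Fin 4 → V) (hp : Function.Injective p) (hq : Function.Injective q)
    (e1 : G.Adj (p 0) (p 1)) (e2 : G.Adj (p 2) (p 3))
    (a : ℕ) (hf : ∀ i, f (q i) = a) : False := by
  obtain ⟨c, c', h1, h2, h3⟩ := nearProper_extend h p q hp hq
  have key : ∀ i j : Fin 4, G.Adj (p i) (p j) →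
      ∃ k, (k = i ∨ k = j) ∧ c (p k) ≠ c' (p k) := by
    intro i j e
    by_contra hcon
    push Not at hcon
    have a := hcon i (Or.inl rfl)
    have b := hcon j (Or.inr rfl)
    apply h2 e
    rw [← a, ← b, h1, h1, hf, hf]
  obtain ⟨i, hi, hi'⟩ := key 0 1 e1
  obtain ⟨j, hj, hj'⟩ := key 2 3 e2
  have hij : i ≠ j := by rcases hi with rfl | rfl <;> rcases hj with rfl | rfl <;> decide
  have := (h3 _ _ (hp.ne hij) hi' hj').1
  apply hj'
  rw [this, h1, h1, hf, hf]

lemma no_triangle {G : SimpleGraph V} {f : V → ℕ} (h : NearProper G f)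
    (p q : Fin 3 → V) (hp : Function.Injective p) (hq : Function.Injective q)
    (e1 : G.Adj (p 0) (p 1)) (e2 : G.Adj (p 1) (p 2)) (e3 : G.Adj (p 2) (p 0))
    (a : ℕ) (hf : ∀ i, f (q i) = a) : False := by
  obtain ⟨c, c', h1, h2, h3⟩ := nearProper_extend h p q hp hq
  have hc : ∀ i, c (p i) = a := fun i => (h1 i).trans (hf i)
  have h01 := h3 _ _ (hp.ne (show (0 : Fin 3) ≠ 1 by decide))
  have h02 := h3 _ _ (hp.ne (show (0 : Fin 3) ≠ 2 by decide))
  have h12 := h3 _ _ (hp.ne (show (1 : Fin 3) ≠ 2 by decide))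
  have a1 := h2 e1
  have a2 := h2 e2
  have a3 := h2 e3
  rw [hc, hc] at h01 h02 h12
  grind

lemma no_pentagon {G : SimpleGraph V} {f : V → ℕ} (h : NearProper G f)
    (p q : Fin 5 → V) (hp : Function.Injective p) (hq : Function.Injective q)
    (e1 : G.Adj (p 0) (p 1)) (e2 : G.Adj (p 1) (p 2)) (e3 : G.Adj (p 2) (p 3))
    (e4 : G.Adj (p 3) (p 4)) (e5 : G.Adj (p 4) (p 0))
    (f1 : f (q 0) = f (q 1)) (f2 : f (q 1) = f (q 2)) (f3 : f (q 3) = f (q 4)) : False := by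
  obtain ⟨c, c', h1, h2, h3⟩ := nearProper_extend h p q hp hq
  have g1 : c (p 0) = c (p 1) := by rw [h1, h1, f1]
  have g2 : c (p 1) = c (p 2) := by rw [h1, h1, f2]
  have g3 : c (p 3) = c (p 4) := by rw [h1, h1, f3]
  have a1 := h2 e1
  have a2 := h2 e2
  have a3 := h2 e3
  have a4 := h2 e4
  have a5 := h2 e5
  have n01 := hp.ne (show (0 : Fin 5) ≠ 1 by decide)
  have n02 := hp.ne (show (0 : Fin 5) ≠ 2 by decide)
  have n03 := hp.ne (show (0 : Fin 5) ≠ 3 by decide)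
  have n04 := hp.ne (show (0 : Fin 5) ≠ 4 by decide)
  have n12 := hp.ne (show (1 : Fin 5) ≠ 2 by decide)
  have n13 := hp.ne (show (1 : Fin 5) ≠ 3 by decide)
  have n14 := hp.ne (show (1 : Fin 5) ≠ 4 by decide)
  have n23 := hp.ne (show (2 : Fin 5) ≠ 3 by decide)
  have n24 := hp.ne (show (2 : Fin 5) ≠ 4 by decide)
  have n34 := hp.ne (show (3 : Fin 5) ≠ 4 by decide)
  have m03 := h3 _ _ n03
  have m04 := h3 _ _ n04
  have m13 := h3 _ _ n13
  have m14 := h3 _ _ n14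
  have m23 := h3 _ _ n23
  have m24 := h3 _ _ n24
  generalize p 0 = v0 at *
  generalize p 1 = v1 at *
  generalize p 2 = v2 at *
  generalize p 3 = v3 at *
  generalize p 4 = v4 at *
  clear h1 h3 h2 hp hq
  by_cases b3 : c v3 = c' v3
  · by_cases b4 : c v4 = c' v4
    · exact a4 (by rw [← b3, ← b4, g3])
    · grind
  · grind

/-- A graph that is not 2-colorable contains an odd cycle. -/
lemma exists_odd_cycle (G : SimpleGraph V) (h : ¬ G.Colorable 2) :
    ∃ (L : ℕ) (g : ℕ → V), Odd L ∧ Set.InjOn g {i | i < L} ∧ (∀ i, i < L → G.Adj (g i) (g (i+1))) ∧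
      g L = g 0 := by
  classical
  rw [SimpleGraph.two_colorable_iff_forall_loop_even] at h
  push Not at h
  have hex : ∃ n : ℕ, ∃ u, ∃ w : G.Walk u u, w.length = n ∧ Odd n := by
    obtain ⟨u, w, hw⟩ := h
    exact ⟨_, u, w, rfl, by simpa using hw⟩
  obtain ⟨u, w, hw, hodd⟩ := Nat.find_spec hex
  have hmin : ∀ a b (w' : G.Walk a b), a = b → Odd w'.length → Nat.find hex ≤ w'.length := by
    intro a b w' hab ho
    subst hab
    exact Nat.find_min' hex ⟨a, w', rfl, ho⟩
  generalize Nat.find hex = L at *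
  have main : ∀ i j, i < j → j < L → w.getVert i ≠ w.getVert j := by
    intro i j hij hj he
    by_cases ho : Odd (j - i)
    · have h1 := hmin _ _ ((w.drop i).take (j - i)) (by
        rw [SimpleGraph.Walk.drop_getVert, he]; congr 1; omega)
      rw [SimpleGraph.Walk.take_length, SimpleGraph.Walk.drop_length, hw] at h1
      have : min (j - i) (L - i) = j - i := by omega
      rw [this] at h1
      have := h1 ho
      omega
    · have h1 := hmin _ _ ((w.take i).append ((w.drop j).copy he.symm rfl)) rfl
      rw [SimpleGraph.Walk.length_append, SimpleGraph.Walk.length_copy,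
        SimpleGraph.Walk.take_length, SimpleGraph.Walk.drop_length, hw] at h1
      have : min i L = i := by omega
      rw [this] at h1
      have := h1 (by
        rw [Nat.odd_iff] at *
        omega)
      omega
  refine ⟨L, w.getVert, hodd, ?_, ?_, ?_⟩
  · intro i hi j hj he
    rcases lt_trichotomy i j with hlt | rfl | hlt
    · exact absurd he (main i j hlt hj)
    · rfl
    · exact absurd he.symm (main j i hlt hi)
  · intro i hi
    exact w.adj_getVert_succ (by omega)
  · rw [← hw]; simp

lemma odd_cycle_cases (G : SimpleGraph V) (h : ¬ G.Colorable 2) :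
    (∃ p : Fin 3 → V, Function.Injective p ∧ G.Adj (p 0) (p 1) ∧ G.Adj (p 1) (p 2) ∧
      G.Adj (p 2) (p 0)) ∨
    (∃ p : Fin 5 → V, Function.Injective p ∧ G.Adj (p 0) (p 1) ∧ G.Adj (p 1) (p 2) ∧
      G.Adj (p 2) (p 3) ∧ G.Adj (p 3) (p 4) ∧ G.Adj (p 4) (p 0)) ∨
    (7 ≤ Fintype.card V ∧ ∃ p : Fin 6 → V, Function.Injective p ∧ G.Adj (p 0) (p 1) ∧
      G.Adj (p 2) (p 3) ∧ G.Adj (p 4) (p 5)) := by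
  obtain ⟨L, g, hodd, hinj, hadj, hend⟩ := exists_odd_cycle G h
  have hin : ∀ n, n ≤ L → Function.Injective (fun i : Fin n => g i) := by
    intro n hn i j hij
    have := hinj (show (i : ℕ) < L by omega) (show (j : ℕ) < L by omega) hij
    exact Fin.ext this
  have h1 : L ≠ 1 := by
    rintro rfl
    have := hadj 0 (by omega)
    rw [zero_add, hend] at this
    exact this.ne rfl
  by_cases h3 : L = 3
  · subst h3
    left
    refine ⟨_, hin 3 le_rfl, hadj 0 (by omega), hadj 1 (by omega), ?_⟩
    have := hadj 2 (by omega)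
    rw [hend] at this
    exact this
  by_cases h5 : L = 5
  · subst h5
    right; left
    refine ⟨_, hin 5 le_rfl, hadj 0 (by omega), hadj 1 (by omega), hadj 2 (by omega),
      hadj 3 (by omega), ?_⟩
    have := hadj 4 (by omega)
    rw [hend] at this
    exact this
  have h7 : 7 ≤ L := by
    rw [Nat.odd_iff] at hodd
    omega
  right; right
  constructor
  · simpa using Fintype.card_le_of_injective _ (hin 7 h7)
  · exact ⟨_, hin 6 (by omega), hadj 0 (by omega), hadj 2 (by omega), hadj 4 (by omega)⟩

/-- Size of a color class. -/
def clsCard (f : V → Fin 3) (i : Fin 3) : ℕ := (univ.filter fun v => f v = i).card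

lemma sum_clsCard (f : V → Fin 3) : clsCard f 0 + clsCard f 1 + clsCard f 2 = Fintype.card V := by
  have := Finset.card_eq_sum_card_fiberwise (f := f) (s := univ) (t := univ) (by simp)
  rw [Fin.sum_univ_three] at this
  exact this.symm

lemma clsCard_emb (f : V → Fin 3) (i : Fin 3) (n : ℕ) (h : n ≤ clsCard f i) :
    ∃ q : Fin n → V, Function.Injective q ∧ ∀ j, f (q j) = i := by
  obtain ⟨t, ht, hc⟩ := Finset.exists_subset_card_eq h
  let e := t.equivFinOfCardEq hc
  refine ⟨fun j => (e.symm j : V), fun a b hab => e.symm.injective (Subtype.ext hab), fun j => ?_⟩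
  have := ht (e.symm j).2
  simpa using this

lemma clsCard_update (f : V → Fin 3) (v : V) (i : Fin 3) (hi : i ≠ f v) :
    clsCard (Function.update f v i) i = clsCard f i + 1 ∧
    clsCard (Function.update f v i) (f v) + 1 = clsCard f (f v) ∧
    ∀ k, k ≠ i → k ≠ f v → clsCard (Function.update f v i) k = clsCard f k := by
  unfold clsCard
  refine ⟨?_, ?_, ?_⟩
  · rw [← Finset.card_insert_of_notMem (a := v) (by simpa using hi.symm)]
    congr 1
    ext u
    by_cases hu : u = v <;> simp [hu, Function.update]
  · rw [← Finset.card_insert_of_notMem (a := v) (by simpa using hi)]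
    congr 1
    ext u
    by_cases hu : u = v <;> simp [hu, Function.update]
  · intro k hk hk'
    congr 1
    ext u
    by_cases hu : u = v <;> simp [hu, Function.update, hk.symm, hk'.symm]

/-- Properness for colorings with three colors. -/
def P3 (G : SimpleGraph V) (f : V → Fin 3) : Prop := ∀ ⦃u v⦄, G.Adj u v → f u ≠ f v

lemma P3_update {G : SimpleGraph V} {f : V → Fin 3} (hf : P3 G f) (v : V) (i : Fin 3)
    (h : ∀ u, f u = i → ¬ G.Adj v u) : P3 G (Function.update f v i) := by
  intro a b hab
  have hne := hab.ne
  by_cases ha : a = v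
  · subst ha
    have : b ≠ a := hne.symm
    rw [Function.update_self, Function.update_of_ne this]
    exact fun hh => h b hh.symm hab
  · by_cases hb : b = v
    · subst hb
      rw [Function.update_self, Function.update_of_ne ha]
      exact fun hh => h a hh hab.symm
    · rw [Function.update_of_ne ha, Function.update_of_ne hb]
      exact hf hab

lemma nearProper_three (G : SimpleGraph V) (hB : villainy G = 2) (hchi : chromNum G = 3)
    (h2 : ¬ G.Colorable 2) (f : V → Fin 3) (hf : P3 G f) : NearProper G (fun v => (f v : ℕ)) := by
  apply nearProper_of_villainy G hB
  refine ⟨fun u v huv h => hf huv (Fin.ext h), ?_⟩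
  rw [hchi]
  apply le_antisymm
  · have : univ.image (fun v => (f v : ℕ)) ⊆ Finset.range 3 := by
      intro x hx
      simp only [mem_image, mem_univ, true_and] at hx
      obtain ⟨v, rfl⟩ := hx
      simp
    simpa using Finset.card_le_card this
  · by_contra hlt
    apply h2
    have C : G.Coloring (univ.image (fun v => (f v : ℕ))) :=
      SimpleGraph.Coloring.mk (fun v => ⟨(f v : ℕ), Finset.mem_image_of_mem _ (mem_univ v)⟩) (by
        intro u v huv h
        exact hf huv (Fin.ext (by simpa using h)))
    have := C.colorable
    rw [Fintype.card_coe] at this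
    exact this.mono (by omega)

/-- All classes of size at least two: no three disjoint edges. -/
lemma no_matching {G : SimpleGraph V} {f : V → Fin 3} (h : NearProper G (fun v => (f v : ℕ)))
    (hc : ∀ i, 2 ≤ clsCard f i) (p : Fin 6 → V) (hp : Function.Injective p)
    (e1 : G.Adj (p 0) (p 1)) (e2 : G.Adj (p 2) (p 3)) (e3 : G.Adj (p 4) (p 5)) : False := by
  obtain ⟨a, ha, ha'⟩ := clsCard_emb f 0 2 (hc 0)
  obtain ⟨b, hb, hb'⟩ := clsCard_emb f 1 2 (hc 1)
  obtain ⟨c, hcc, hc'⟩ := clsCard_emb f 2 2 (hc 2)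
  have na := ha.ne (show (0 : Fin 2) ≠ 1 by decide)
  have nb := hb.ne (show (0 : Fin 2) ≠ 1 by decide)
  have nc := hcc.ne (show (0 : Fin 2) ≠ 1 by decide)
  have nab : ∀ i j, a i ≠ b j := fun i j hh => by
    have := ha' i; rw [hh, hb' j] at this; exact absurd this (by decide)
  have nac : ∀ i j, a i ≠ c j := fun i j hh => by
    have := ha' i; rw [hh, hc' j] at this; exact absurd this (by decide)
  have nbc : ∀ i j, b i ≠ c j := fun i j hh => by
    have := hb' i; rw [hh, hc' j] at this; exact absurd this (by decide)
  refine no_three_edges h p ![a 0, a 1, b 0, b 1, c 0, c 1] hp ?_ e1 e2 e3 ?_ ?_ ?_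
  · intro i j hij
    fin_cases i <;> fin_cases j <;> first | rfl | (exfalso; simp_all [eq_comm])
  · simp [ha']
  · simp [hb']
  · simp [hc']


lemma cls_le_three {G : SimpleGraph V} {f : V → Fin 3} (h : NearProper G (fun v => (f v : ℕ)))
    (h2 : ¬ G.Colorable 2) (i : Fin 3) : clsCard f i ≤ 3 := by
  by_contra hlt
  push Not at hlt
  have hred : ∀ n (p : Fin n → V), Function.Injective p → ∀ g : Fin 4 → Fin n,
      Function.Injective g → G.Adj (p (g 0)) (p (g 1)) → G.Adj (p (g 2)) (p (g 3)) → False := by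
    intro n p hp g hg e1 e2
    obtain ⟨q, hq, hq'⟩ := clsCard_emb f i 4 hlt
    exact no_two_edges h (p ∘ g) q (hp.comp hg) hq e1 e2 (i : ℕ) (fun j => by simp [hq'])
  rcases odd_cycle_cases G h2 with ⟨p, hp, e1, e2, e3⟩ | ⟨p, hp, e1, e2, e3, e4, e5⟩ |
    ⟨_, p, hp, e1, e2, e3⟩
  · obtain ⟨q, hq, hq'⟩ := clsCard_emb f i 3 (by omega)
    exact no_triangle h p q hp hq e1 e2 e3 (i : ℕ) (fun j => by simp [hq'])
  · exact hred 5 p hp ![0, 1, 2, 3] (by decide) e1 e3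
  · exact hred 6 p hp ![0, 1, 2, 3] (by decide) e1 e2

/-- A class of size three and another of size two exclude triangles and pentagons. -/
lemma three_two {G : SimpleGraph V} {f : V → Fin 3} (h : NearProper G (fun v => (f v : ℕ)))
    (h2 : ¬ G.Colorable 2) (i j : Fin 3) (hij : i ≠ j) (hi : 3 ≤ clsCard f i)
    (hj : 2 ≤ clsCard f j) :
    (7 ≤ Fintype.card V ∧ ∃ p : Fin 6 → V, Function.Injective p ∧ G.Adj (p 0) (p 1) ∧
      G.Adj (p 2) (p 3) ∧ G.Adj (p 4) (p 5)) := by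
  obtain ⟨a, ha, ha'⟩ := clsCard_emb f i 3 hi
  obtain ⟨b, hb, hb'⟩ := clsCard_emb f j 2 hj
  rcases odd_cycle_cases G h2 with ⟨p, hp, e1, e2, e3⟩ | ⟨p, hp, e1, e2, e3, e4, e5⟩ | h7
  · exact (no_triangle h p a hp ha e1 e2 e3 (i : ℕ) (fun j => by simp [ha'])).elim
  · exfalso
    have n01 := ha.ne (show (0 : Fin 3) ≠ 1 by decide)
    have n02 := ha.ne (show (0 : Fin 3) ≠ 2 by decide)
    have n12 := ha.ne (show (1 : Fin 3) ≠ 2 by decide)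
    have nb := hb.ne (show (0 : Fin 2) ≠ 1 by decide)
    have nab : ∀ k l, a k ≠ b l := fun k l hh => by
      have := ha' k; rw [hh, hb' l] at this; exact hij this.symm
    refine no_pentagon h p ![a 0, a 1, a 2, b 0, b 1] hp ?_ e1 e2 e3 e4 e5 ?_ ?_ ?_
    · clear ha' hb' hij
      have r1 := nab 0 0
      have r2 := nab 0 1
      have r3 := nab 1 0
      have r4 := nab 1 1
      have r5 := nab 2 0
      have r6 := nab 2 1
      clear nab
      generalize a 0 = a0 at *
      generalize a 1 = a1 at *
      generalize a 2 = a2 at *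
      generalize b 0 = b0 at *
      generalize b 1 = b1 at *
      clear h h2 hp ha hb
      intro i j hij
      fin_cases i <;> fin_cases j <;> first | rfl | (exfalso; simp_all [eq_comm])
    · simp [ha']
    · simp [ha']
    · simp [hb']
  · exact h7

/-- In a graph as in the theorem on at least six vertices all classes have size two. -/
lemma cls_eq_two {G : SimpleGraph V}
    (h : ∀ f : V → Fin 3, P3 G f → NearProper G (fun v => (f v : ℕ)))
    (h2 : ¬ G.Colorable 2) (h6 : 6 ≤ Fintype.card V) (f : V → Fin 3) (hf : P3 G f) (i : Fin 3) :
    clsCard f i = 2 := by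
  have hle : ∀ i, clsCard f i ≤ 3 := cls_le_three (h f hf) h2
  have hsum := sum_clsCard f
  by_contra hne
  have l0 := hle 0
  have l1 := hle 1
  have l2 := hle 2
  obtain ⟨a, b, hab, ha, hb⟩ : ∃ a b, a ≠ b ∧ 3 ≤ clsCard f a ∧ 2 ≤ clsCard f b := by
    by_cases c0 : 3 ≤ clsCard f 0
    · by_cases c1 : 2 ≤ clsCard f 1
      · exact ⟨0, 1, by decide, c0, c1⟩
      · exact ⟨0, 2, by decide, c0, by omega⟩
    by_cases c1 : 3 ≤ clsCard f 1
    · by_cases c1 : 2 ≤ clsCard f 0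
      · exact ⟨1, 0, by decide, by assumption, c1⟩
      · exact ⟨1, 2, by decide, by assumption, by omega⟩
    by_cases c2 : 3 ≤ clsCard f 2
    · by_cases c1 : 2 ≤ clsCard f 0
      · exact ⟨2, 0, by decide, by assumption, c1⟩
      · exact ⟨2, 1, by decide, by assumption, by omega⟩
    fin_cases i <;> simp at hne <;> omega
  obtain ⟨h7, p, hp, e1, e2, e3⟩ := three_two (h f hf) h2 a b hab ha hb
  by_cases hall : ∀ k, 2 ≤ clsCard f k
  · exact no_matching (h f hf) hall p hp e1 e2 e3
  push Not at hall
  obtain ⟨k, hk⟩ := hall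
  have hk1 : clsCard f k = 1 ∧ ∀ l, l ≠ k → clsCard f l = 3 := by
    constructor
    · fin_cases k <;> simp at hk ⊢ <;> omega
    · intro l hl
      fin_cases k <;> fin_cases l <;> simp at hk hl ⊢ <;> omega
  obtain ⟨w, hw⟩ := Finset.card_eq_one.mp hk1.1
  have hw' : ∀ u, f u = k ↔ u = w := by
    intro u
    have : u ∈ univ.filter (fun v => f v = k) ↔ u ∈ ({w} : Finset V) := by rw [hw]
    simpa using this
  by_cases hex : ∃ u, u ≠ w ∧ ¬ G.Adj u w
  · obtain ⟨u, huw, hna⟩ := hex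
    have hku : k ≠ f u := fun hh => huw ((hw' u).1 hh.symm)
    have hg : P3 G (Function.update f u k) := P3_update hf u k (by
      intro x hx hadj
      rw [hw'] at hx
      subst hx
      exact hna hadj)
    obtain ⟨c1, c2, c3⟩ := clsCard_update f u k hku
    refine no_matching (h _ hg) ?_ p hp e1 e2 e3
    intro l
    by_cases hl : l = k
    · rw [hl, c1]; omega
    by_cases hl' : l = f u
    · rw [hl'] at hl ⊢
      have := hk1.2 _ hl
      omega
    · rw [c3 l hl hl', hk1.2 l hl]; omega
  · push Not at hex
    obtain ⟨q, hq, hq'⟩ := clsCard_emb f a 3 ha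
    have hno : ∀ x y, x ≠ w → y ≠ w → ¬ G.Adj x y := by
      intro x y hx hy hxy
      refine no_triangle (h f hf) ![x, y, w] q ?_ hq hxy (hex y hy) (hex x hx).symm
        (a : ℕ) (fun j => by simp [hq'])
      have hne := hxy.ne
      intro i j hij
      fin_cases i <;> fin_cases j <;> first | rfl | (exfalso; simp_all [eq_comm])
    apply h2
    refine ⟨SimpleGraph.Coloring.mk (fun v => if v = w then (0 : Fin 2) else 1) ?_⟩
    intro x y hxy
    by_cases hx : x = w
    · have hy : y ≠ w := fun hh => hxy.ne (hx.trans hh.symm)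
      simp [hx, hy]
    · by_cases hy : y = w
      · simp [hx, hy]
      · exact (hno x y hx hy hxy).elim

lemma inj_six {a b c d e g : V} (h : [a, b, c, d, e, g].Nodup) :
    Function.Injective ![a, b, c, d, e, g] := by
  simp only [List.nodup_cons, List.mem_cons, List.not_mem_nil, List.nodup_nil, not_or] at h
  intro i j hij
  fin_cases i <;> fin_cases j <;> first | rfl | (exfalso; simp_all [eq_comm])

lemma nodup_six {a b c d e g : V}
    (h : a ≠ b ∧ a ≠ c ∧ a ≠ d ∧ a ≠ e ∧ a ≠ g ∧ b ≠ c ∧ b ≠ d ∧ b ≠ e ∧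
        b ≠ g ∧ c ≠ d ∧ c ≠ e ∧ c ≠ g ∧ d ≠ e ∧ d ≠ g ∧ e ≠ g) : [a, b, c, d, e, g].Nodup := by
  simp [h]

set_option maxHeartbeats 2000000 in
/-- The case of six vertices. -/
lemma six_case {G : SimpleGraph V}
    (h : ∀ f : V → Fin 3, P3 G f → NearProper G (fun v => (f v : ℕ)))
    (h2 : ¬ G.Colorable 2) (h6 : Fintype.card V = 6) (f : V → Fin 3) (hf : P3 G f) :
    Nonempty (G ≃g ((⊤ : SimpleGraph (Fin 3)) ⊕g (⊤ : SimpleGraph (Fin 3)))) := by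
  have htwo := cls_eq_two h h2 h6.ge
  have hnm : ∀ a b c d e g : V, [a, b, c, d, e, g].Nodup → G.Adj a b → G.Adj c d → ¬ G.Adj e g := by
    intro a b c d e g hnd e1 e2 e3
    exact no_matching (h f hf) (fun i => (htwo f hf i).ge) ![a, b, c, d, e, g] (inj_six hnd) e1 e2 e3
  have hmove : ∀ v i, i ≠ f v → ∃ u, f u = i ∧ G.Adj v u := by
    intro v i hi
    by_contra hcon
    push Not at hcon
    have hg := P3_update hf v i hcon
    have := (clsCard_update f v i hi).1
    rw [htwo _ hg, htwo _ hf] at this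
    omega
  rcases odd_cycle_cases G h2 with ⟨p, hp, e1, e2, e3⟩ | ⟨p, hp, e1, e2, e3, e4, e5⟩ | ⟨h7, _⟩
  · have hpart : ∀ v, ∃ v', v' ≠ v ∧ f v' = f v ∧ ∀ u, f u = f v → u = v ∨ u = v' := by
      intro v
      obtain ⟨x, y, hxy, hs⟩ := Finset.card_eq_two.mp (htwo f hf (f v))
      have hm : ∀ u, f u = f v ↔ u = x ∨ u = y := by
        intro u
        have : u ∈ univ.filter (fun w => f w = f v) ↔ u ∈ ({x, y} : Finset V) := by rw [hs]
        simpa using this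
      rcases (hm v).1 rfl with rfl | rfl
      · exact ⟨y, hxy.symm, (hm y).2 (Or.inr rfl), fun u hu => (hm u).1 hu⟩
      · exact ⟨x, hxy, (hm x).2 (Or.inl rfl), fun u hu => ((hm u).1 hu).symm⟩
    generalize p 0 = x at *
    generalize p 1 = y at *
    generalize p 2 = z at *
    obtain ⟨x', hx, hfx, hx'⟩ := hpart x
    obtain ⟨y', hy, hfy, hy'⟩ := hpart y
    obtain ⟨z', hz, hfz, hz'⟩ := hpart z
    have fxy := hf e1
    have fyz := hf e2
    have fzx := hf e3
    have hnb : ∀ v w w', f v ≠ f w → (∀ u, f u = f w → u = w ∨ u = w') →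
        G.Adj v w ∨ G.Adj v w' := by
      intro v w w' hvw hw
      obtain ⟨u, hu, hadj⟩ := hmove v (f w) hvw.symm
      rcases hw u hu with rfl | rfl
      · exact Or.inl hadj
      · exact Or.inr hadj
    have m1 := hnb x' y y' (by rw [hfx]; exact fxy) hy'
    have m2 := hnb x' z z' (by rw [hfx]; exact fzx.symm) hz'
    have m3 := hnb y' x x' (by rw [hfy]; exact fxy.symm) hx'
    have m4 := hnb y' z z' (by rw [hfy]; exact fyz) hz'
    have m5 := hnb z' x x' (by rw [hfz]; exact fzx) hx'
    have m6 := hnb z' y y' (by rw [hfz]; exact fyz.symm) hy'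
    have hnd : [x, y, z, x', y', z'].Nodup := by
      simp only [List.nodup_cons, List.mem_cons, List.not_mem_nil, List.nodup_nil, not_or]
      clear hnm hnb hmove hpart h htwo m1 m2 m3 m4 m5 m6
      and_intros <;> grind
    have nxx : ¬ G.Adj x x' := fun hh => hf hh hfx.symm
    have nyy : ¬ G.Adj y y' := fun hh => hf hh hfy.symm
    have nzz : ¬ G.Adj z z' := fun hh => hf hh hfz.symm
    have hbij : Function.Bijective ![x, y, z, x', y', z'] := by
      rw [Fintype.bijective_iff_injective_and_card]
      exact ⟨inj_six hnd, by simp [h6]⟩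
    simp only [List.nodup_cons, List.mem_cons, List.not_mem_nil, List.nodup_nil, not_or] at hnd
    have M : ∀ a b c d e g : V, (a ≠ b ∧ a ≠ c ∧ a ≠ d ∧ a ≠ e ∧ a ≠ g ∧ b ≠ c ∧ b ≠ d ∧ b ≠ e ∧
        b ≠ g ∧ c ≠ d ∧ c ≠ e ∧ c ≠ g ∧ d ≠ e ∧ d ≠ g ∧ e ≠ g) →
        G.Adj a b → G.Adj c d → ¬ G.Adj e g := by
      intro a b c d e g hh
      exact hnm a b c d e g (nodup_six hh)
    have k1 := M x y' x' z' y z (by clear hnm M hmove hnb hpart h htwo; and_intros <;> grind)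
    have k2 := M x z' x' y' y z (by clear hnm M hmove hnb hpart h htwo; and_intros <;> grind)
    have k3 := M y x' y' z' x z (by clear hnm M hmove hnb hpart h htwo; and_intros <;> grind)
    have k4 := M y z' y' x' x z (by clear hnm M hmove hnb hpart h htwo; and_intros <;> grind)
    have k5 := M z x' z' y' x y (by clear hnm M hmove hnb hpart h htwo; and_intros <;> grind)
    have k6 := M z y' z' x' x y (by clear hnm M hmove hnb hpart h htwo; and_intros <;> grind)
    have k7 := M x y' y z' z x' (by clear hnm M hmove hnb hpart h htwo; and_intros <;> grind)
    have k8 := M x z' y x' z y' (by clear hnm M hmove hnb hpart h htwo; and_intros <;> grind)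
    have s1 := G.adj_comm x' y'
    have s2 := G.adj_comm x' z'
    have s3 := G.adj_comm y' z'
    have s4 := G.adj_comm x y'
    have s5 := G.adj_comm x z'
    have s6 := G.adj_comm y x'
    have s7 := G.adj_comm y z'
    have s8 := G.adj_comm z x'
    have s9 := G.adj_comm z y'
    have s10 := G.adj_comm x z
    have t1 : G.Adj x' y' ∧ G.Adj y' z' ∧ G.Adj z' x' := by grind
    have t2 : ¬ G.Adj x y' ∧ ¬ G.Adj x z' ∧ ¬ G.Adj y x' ∧ ¬ G.Adj y z' ∧ ¬ G.Adj z x' ∧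
      ¬ G.Adj z y' := by grind
    have hbij2 : Function.Bijective (Sum.elim ![x, y, z] ![x', y', z']) := by
      have : Sum.elim ![x, y, z] ![x', y', z'] = ![x, y, z, x', y', z'] ∘ finSumFinEquiv := by
        funext s
        rcases s with s | s <;> fin_cases s <;> rfl
      rw [this]
      exact hbij.comp (finSumFinEquiv (m := 3) (n := 3)).bijective
    obtain ⟨t1a, t1b, t1c⟩ := t1
    obtain ⟨u1, u2, u3, u4, u5, u6⟩ := t2
    clear hnm M hnb hmove hpart k1 k2 k3 k4 k5 k6 k7 k8 m1 m2 m3 m4 m5 m6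
    have v1 := fun hh => u1 (G.adj_symm hh)
    have v2 := fun hh => u2 (G.adj_symm hh)
    have v3 := fun hh => u3 (G.adj_symm hh)
    have v4 := fun hh => u4 (G.adj_symm hh)
    have v5 := fun hh => u5 (G.adj_symm hh)
    have v6 := fun hh => u6 (G.adj_symm hh)
    have v7 := fun hh => nxx (G.adj_symm hh)
    have v8 := fun hh => nyy (G.adj_symm hh)
    have v9 := fun hh => nzz (G.adj_symm hh)
    refine ⟨(RelIso.symm ⟨Equiv.ofBijective _ hbij2, ?_⟩)⟩
    intro s t
    rcases s with s | s <;> rcases t with t | t <;> fin_cases s <;> fin_cases t <;>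
      simp [e1, e2, e3, e1.symm, e2.symm, e3.symm, t1a, t1b, t1c, t1a.symm, t1b.symm, t1c.symm,
        u1, u2, u3, u4, u5, u6, nxx, nyy, nzz] <;> assumption
  · exfalso
    have hns : ¬ Function.Surjective p := by
      intro hs
      have := Fintype.card_le_of_surjective p hs
      simp [h6] at this
    unfold Function.Surjective at hns
    push Not at hns
    obtain ⟨x, hx⟩ := hns
    have hall : ∀ u, u = x ∨ ∃ i, p i = u := by
      have hinj : Function.Injective ![x, p 0, p 1, p 2, p 3, p 4] := by
        apply inj_six
        simp only [List.nodup_cons, List.mem_cons, List.not_mem_nil, List.nodup_nil, not_or]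
        simp [hp.eq_iff, fun i => (hx i).symm]
      have hbij : Function.Bijective ![x, p 0, p 1, p 2, p 3, p 4] := by
        rw [Fintype.bijective_iff_injective_and_card]
        exact ⟨hinj, by simp [h6]⟩
      intro u
      obtain ⟨i, rfl⟩ := hbij.2 u
      fin_cases i
      · exact Or.inl rfl
      · exact Or.inr ⟨0, rfl⟩
      · exact Or.inr ⟨1, rfl⟩
      · exact Or.inr ⟨2, rfl⟩
      · exact Or.inr ⟨3, rfl⟩
      · exact Or.inr ⟨4, rfl⟩
    obtain ⟨i, hi⟩ : ∃ i : Fin 3, i ≠ f x := exists_ne _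
    obtain ⟨u, -, hadj⟩ := hmove x i hi
    rcases hall u with rfl | ⟨j, rfl⟩
    · exact hadj.ne rfl
    have hnd : ∀ a b c d e : Fin 5, [a, b, c, d, e].Nodup → G.Adj x (p a) → G.Adj (p b) (p c) →
        ¬ G.Adj (p d) (p e) := by
      intro a b c d e hh
      apply hnm
      have : [p a, p b, p c, p d, p e] = [a, b, c, d, e].map p := rfl
      rw [List.nodup_cons, this]
      refine ⟨?_, hh.map hp⟩
      simp only [List.mem_map, not_exists, not_and]
      exact fun i _ => hx i
    fin_cases j
    · exact hnd 0 1 2 3 4 (by decide) hadj e2 e4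
    · exact hnd 1 2 3 4 0 (by decide) hadj e3 e5
    · exact hnd 2 3 4 0 1 (by decide) hadj e4 e1
    · exact hnd 3 4 0 1 2 (by decide) hadj e5 e2
    · exact hnd 4 0 1 2 3 (by decide) hadj e1 e3
  · omega

theorem order_le_six_of_villainy_two_chrom_three (G : SimpleGraph V)
    (hB : villainy G = 2) (hchi : chromNum G = 3) :
    Fintype.card V ≤ 6 ∧
    (Fintype.card V = 6 → Nonempty (G ≃g ((⊤ : SimpleGraph (Fin 3)) ⊕g (⊤ : SimpleGraph (Fin 3))))) := by
  have hchr : G.chromaticNumber = 3 := by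
    unfold chromNum at hchi
    have hne : G.chromaticNumber ≠ ⊤ := by
      intro hh
      rw [hh] at hchi
      simp at hchi
    rw [← ENat.coe_toNat hne, hchi]
    rfl
  have h2 : ¬ G.Colorable 2 := by
    intro hh
    have := hh.chromaticNumber_le
    rw [hchr] at this
    exact absurd this (by decide)
  have h3 : G.Colorable 3 := SimpleGraph.chromaticNumber_le_iff_colorable.mp hchr.le
  obtain ⟨C⟩ := h3
  have hC : P3 G (fun v => C v) := fun u v huv => C.valid huv
  have h := nearProper_three G hB hchi h2
  constructor
  · by_contra hlt
    have htwo := cls_eq_two h h2 (by omega) _ hC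
    have := sum_clsCard (fun v => C v)
    rw [htwo, htwo, htwo] at this
    omega
  · intro h6
    exact six_case h h2 h6 _ hC
end
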